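/- Let H be a separable Hilbert space and let X be a centered Gaussian random vector in H with infinite-dimensional Cameron–Martin space. Assume the ordered nonzero eigenvalues of the covariance operator satisfy λ_j ~ φ(j) as j → ∞, where φ : (s,∞) → (0,∞) is a decreasing function, regularly varying at infinity of index −b for some b > 1 and some s ≥ 0. Set ψ(x) := 1/(x φ(x)) for x > s. Then e_n(X) ~ ((b/2)^{b−1} · b/(b−1))^{1/2} · ψ(log n)^{−1/2} as n → ∞. -/

import Mathlib

open MeasureTheory ProbabilityTheory Filter Real
open scoped RealInnerProductSpace NNReal

/-- The minimal `n`-th `L²`-quantization error of an `H`-valued random vector `X`: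
`e_n(X) = inf {(E min_{a ∈ α} ‖X - a‖²)^{1/2} : α ⊆ H, card α ≤ n}`. -/
noncomputable def quantErr {H : Type*} [NormedAddCommGroup H] [InnerProductSpace ℝ H]
    {Ω : Type*} [MeasurableSpace Ω] (P : Measure Ω) (X : Ω → H) (n : ℕ) : ℝ :=
  sInf { r : ℝ | ∃ α : Finset H, α.Nonempty ∧ α.card ≤ n ∧
    r = (∫ ω, sInf ((fun a => ‖X ω - a‖ ^ 2) '' (α : Set H)) ∂P) ^ (1/2 : ℝ) }

section Coordinates

variable {H : Type*} [NormedAddCommGroup H] [InnerProductSpace ℝ H]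
  {Ω : Type*} [MeasurableSpace Ω] {P : Measure Ω} {X : Ω → H}
  {u : ℕ → H} {lam : ℕ → ℝ}

lemma aemeasurable_inner_of_gaussian
    (hGauss : ∀ y : H, ∃ v : ℝ≥0, Measure.map (fun ω => ⟪y, X ω⟫) P = gaussianReal 0 v) (y : H) :
    AEMeasurable (fun ω => ⟪y, X ω⟫) P := by
  obtain ⟨v, hv⟩ := hGauss y
  apply AEMeasurable.of_map_ne_zero
  rw [hv]
  exact IsProbabilityMeasure.ne_zero _

lemma memLp_inner_of_gaussian
    (hGauss : ∀ y : H, ∃ v : ℝ≥0, Measure.map (fun ω => ⟪y, X ω⟫) P = gaussianReal 0 v) (y : H) :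
    MemLp (fun ω => ⟪y, X ω⟫) 2 P := by
  obtain ⟨v, hv⟩ := hGauss y
  have h := memLp_id_gaussianReal (μ := 0) (v := v) 2
  rw [← hv] at h
  exact h.comp_of_map (aemeasurable_inner_of_gaussian hGauss y)

lemma integral_inner_of_gaussian
    (hGauss : ∀ y : H, ∃ v : ℝ≥0, Measure.map (fun ω => ⟪y, X ω⟫) P = gaussianReal 0 v) (y : H) :
    ∫ ω, ⟪y, X ω⟫ ∂P = 0 := by
  obtain ⟨v, hv⟩ := hGauss y
  have h := integral_map (aemeasurable_inner_of_gaussian hGauss y) (f := fun x : ℝ => x)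
    aestronglyMeasurable_id
  rw [← h, hv, integral_id_gaussianReal]

/-- The law of a coordinate along an eigenvector. -/
lemma map_inner_eigenvector
    (hGauss : ∀ y : H, ∃ v : ℝ≥0, Measure.map (fun ω => ⟪y, X ω⟫) P = gaussianReal 0 v)
    (hu : Orthonormal ℝ u)
    (heig : ∀ j, ∀ y : H, ∫ ω, ⟪u j, X ω⟫ * ⟪y, X ω⟫ ∂P = lam j * ⟪u j, y⟫) (j : ℕ) :
    Measure.map (fun ω => ⟪u j, X ω⟫) P = gaussianReal 0 (lam j).toNNReal := by
  obtain ⟨v, hv⟩ := hGauss (u j)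
  have h1 : Var[fun ω => ⟪u j, X ω⟫; P] = v := by
    have := variance_fun_id_gaussianReal (μ := 0) (v := v)
    rw [← hv, variance_map aemeasurable_id' (aemeasurable_inner_of_gaussian hGauss _)] at this
    exact this
  rw [variance_of_integral_eq_zero (aemeasurable_inner_of_gaussian hGauss _)
    (integral_inner_of_gaussian hGauss _)] at h1
  have h2 := heig j (u j)
  simp only [real_inner_self_eq_norm_sq, hu.1 j] at h2
  have h3 : lam j = v := by
    rw [← h1]; simp only [pow_two]; rw [h2]; simp
  rw [hv, h3, Real.toNNReal_coe]

lemma map_coords_eq_pi [IsProbabilityMeasure P]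
    (hGauss : ∀ y : H, ∃ v : ℝ≥0, Measure.map (fun ω => ⟪y, X ω⟫) P = gaussianReal 0 v)
    (hu : Orthonormal ℝ u)
    (heig : ∀ j, ∀ y : H, ∫ ω, ⟪u j, X ω⟫ * ⟪y, X ω⟫ ∂P = lam j * ⟪u j, y⟫) (N : ℕ) :
    Measure.map (fun ω (j : Fin N) => ⟪u j, X ω⟫) P =
      Measure.pi fun j : Fin N => gaussianReal 0 (lam j).toNNReal := by
  have hm : ∀ j : Fin N, AEMeasurable (fun ω => ⟪u j, X ω⟫) P :=
    fun j => aemeasurable_inner_of_gaussian hGauss _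
  have hmm : AEMeasurable (fun ω (j : Fin N) => ⟪u j, X ω⟫) P := aemeasurable_pi_lambda _ hm
  have hG : HasGaussianLaw (fun ω (j : Fin N) => ⟪u j, X ω⟫) P := by
    refine ⟨isGaussian_of_map_eq_gaussianReal fun L => ?_⟩
    obtain ⟨v, hv⟩ := hGauss (∑ j : Fin N, L (Pi.single j 1) • u j)
    refine ⟨0, v, ?_⟩
    rw [← hv, AEMeasurable.map_map_of_aemeasurable (by fun_prop) hmm]
    congr 1
    ext ω
    simp only [Function.comp, sum_inner, inner_smul_left]
    have h := LinearMap.pi_apply_eq_sum_univ L.toLinearMap (fun j : Fin N => ⟪u j, X ω⟫)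
    simp only [ContinuousLinearMap.coe_coe] at h
    rw [h]
    refine Finset.sum_congr rfl fun j _ => ?_
    rw [smul_eq_mul, mul_comm]
    have hs : (fun i => if j = i then (1 : ℝ) else 0) = Pi.single j 1 := by
      ext i
      simp [Pi.single_apply, eq_comm]
    rw [hs]
    rfl
  have hind : iIndepFun (fun (j : Fin N) ω => ⟪u j, X ω⟫) P := by
    refine hG.iIndepFun_of_covariance_eq_zero fun i j hij => ?_
    rw [covariance_eq_sub (memLp_inner_of_gaussian hGauss _) (memLp_inner_of_gaussian hGauss _),
      integral_inner_of_gaussian hGauss]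
    have h2 := heig i (u j)
    rw [hu.2 (fun h => hij (Fin.ext h))] at h2
    simpa using h2
  rw [iIndepFun_iff_map_fun_eq_pi_map hm] at hind
  rw [hind]
  congr 1
  ext1 j
  exact map_inner_eigenvector hGauss hu heig j

end Coordinates

section GaussianIntegrals

lemma lintegral_gaussianReal {v : ℝ≥0} (hv : v ≠ 0) (μ : ℝ) (F : ℝ → ENNReal) :
    ∫⁻ x, F x ∂gaussianReal μ v = ∫⁻ x, ENNReal.ofReal (gaussianPDFReal μ v x) * F x := by
  rw [gaussianReal_of_var_ne_zero _ hv,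
    lintegral_withDensity_eq_lintegral_mul_non_measurable _ (measurable_gaussianPDF _ _)
      (Eventually.of_forall fun x => gaussianPDF_lt_top)]
  rfl

/-- The joint density, with respect to the product of the marginals, of `(Y + Z, Y)` where
`Y ~ N(0, l - t)` and `Z ~ N(0, t)` are independent. -/
noncomputable def channelDensity (l t x y : ℝ) : ℝ :=
  √(l / t) * exp (-(x - y) ^ 2 / (2 * t) + x ^ 2 / (2 * l))

lemma channelDensity_nonneg (l t x y : ℝ) : 0 ≤ channelDensity l t x y := by
  unfold channelDensity; positivity

lemma gaussianPDFReal_mul_channelDensity {l t : ℝ} (hl : 0 < l) (ht : 0 < t) (x y : ℝ) :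
    gaussianPDFReal 0 l.toNNReal x * channelDensity l t x y = gaussianPDFReal y t.toNNReal x := by
  have h1 : √(2 * π * t) * √(l / t) = √(2 * π * l) := by
    rw [← sqrt_mul (by positivity)]; congr 1; field_simp
  have hp : √(2 * π * t) ≠ 0 := (sqrt_pos.2 (by positivity)).ne'
  have hp' : √(l / t) ≠ 0 := (sqrt_pos.2 (by positivity)).ne'
  have h2 : exp (-(x - 0) ^ 2 / (2 * l)) * exp (-(x - y) ^ 2 / (2 * t) + x ^ 2 / (2 * l)) =
      exp (-(x - y) ^ 2 / (2 * t)) := by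
    rw [← exp_add]; congr 1; ring
  simp only [gaussianPDFReal, channelDensity, Real.coe_toNNReal _ hl.le, Real.coe_toNNReal _ ht.le]
  rw [← h2, ← h1]
  field_simp

lemma lintegral_channelDensity_mul {l t : ℝ} (hl : 0 < l) (ht : 0 < t) (y : ℝ) (F : ℝ → ENNReal) :
    ∫⁻ x, ENNReal.ofReal (channelDensity l t x y) * F x ∂gaussianReal 0 l.toNNReal =
      ∫⁻ x, F x ∂gaussianReal y t.toNNReal := by
  rw [lintegral_gaussianReal (by simpa using hl), lintegral_gaussianReal (by simpa using ht)]
  refine lintegral_congr fun x => ?_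
  rw [← mul_assoc, ← ENNReal.ofReal_mul (gaussianPDFReal_nonneg _ _ _),
    gaussianPDFReal_mul_channelDensity hl ht]

lemma lintegral_channelDensity_right {l t : ℝ} (ht : 0 < t) (htl : t ≤ l) (x : ℝ) :
    ∫⁻ y, ENNReal.ofReal (channelDensity l t x y) ∂gaussianReal 0 (l - t).toNNReal = 1 := by
  rcases htl.eq_or_lt with rfl | h
  · have : (t - t).toNNReal = 0 := by simp
    rw [this, gaussianReal_zero_var, lintegral_dirac]
    simp [channelDensity, div_self ht.ne', neg_div]
  · have hl : 0 < l := ht.trans h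
    have hd : 0 < l - t := sub_pos.2 h
    rw [lintegral_gaussianReal (by simpa using h)]
    have hw : 0 < t * (l - t) / l := by positivity
    rw [← lintegral_gaussianPDFReal_eq_one ((l - t) / l * x) (v := (t * (l - t) / l).toNNReal)
      (by simpa using hw)]
    refine lintegral_congr fun y => ?_
    rw [← ENNReal.ofReal_mul (gaussianPDFReal_nonneg _ _ _)]
    congr 1
    simp only [gaussianPDFReal, channelDensity, Real.coe_toNNReal _ hw.le,
      Real.coe_toNNReal _ hd.le]
    have h1 : √(2 * π * (t * (l - t) / l)) * √(l / t) = √(2 * π * (l - t)) := by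
      rw [← sqrt_mul (by positivity)]; congr 1; field_simp
    have hp : √(2 * π * (t * (l - t) / l)) ≠ 0 := (sqrt_pos.2 (by positivity)).ne'
    have hp' : √(l / t) ≠ 0 := (sqrt_pos.2 (by positivity)).ne'
    have h2 : exp (-(y - 0) ^ 2 / (2 * (l - t))) *
        exp (-(x - y) ^ 2 / (2 * t) + x ^ 2 / (2 * l)) =
        exp (-(y - (l - t) / l * x) ^ 2 / (2 * (t * (l - t) / l))) := by
      rw [← exp_add]; congr 1; field_simp; ring
    rw [← h2, ← h1]
    field_simp

lemma lintegral_exp_sq_gaussianReal {t s : ℝ} (ht : 0 < t) (hs : s < 1 / 2) (y : ℝ) :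
    ∫⁻ x, ENNReal.ofReal (exp (s * ((x - y) ^ 2 / t))) ∂gaussianReal y t.toNNReal =
      ENNReal.ofReal ((√(1 - 2 * s))⁻¹) := by
  have hs' : 0 < 1 - 2 * s := by linarith
  have hw : 0 < t / (1 - 2 * s) := by positivity
  rw [lintegral_gaussianReal (by simpa using ht)]
  rw [← mul_one (ENNReal.ofReal ((√(1 - 2 * s))⁻¹)),
    ← lintegral_gaussianPDFReal_eq_one y (v := (t / (1 - 2 * s)).toNNReal) (by simpa using hw),
    ← lintegral_const_mul _ (by fun_prop)]
  refine lintegral_congr fun x => ?_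
  rw [← ENNReal.ofReal_mul (gaussianPDFReal_nonneg _ _ _), ← ENNReal.ofReal_mul (by positivity)]
  congr 1
  simp only [gaussianPDFReal, Real.coe_toNNReal _ hw.le, Real.coe_toNNReal _ ht.le]
  have h1 : √(2 * π * t) = √(1 - 2 * s) * √(2 * π * (t / (1 - 2 * s))) := by
    rw [← sqrt_mul (by positivity)]; congr 1; field_simp
  have h2 : exp (-(x - y) ^ 2 / (2 * t)) * exp (s * ((x - y) ^ 2 / t)) =
      exp (-(x - y) ^ 2 / (2 * (t / (1 - 2 * s)))) := by
    rw [← exp_add]; congr 1; field_simp; ring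
  rw [h1, ← h2, mul_inv]
  ring

/-- The one-dimensional estimate behind the Shannon lower bound. -/
lemma lintegral_exp_shift_le {l t : ℝ} (hl : 0 < l) (ht : 0 < t) (a : ℝ) :
    ∫⁻ x, ENNReal.ofReal (exp (-(x - a) ^ 2 / (2 * t) + x ^ 2 / (2 * max l t)))
        ∂gaussianReal 0 l.toNNReal ≤
      ENNReal.ofReal (exp (-(1 / 2 * log (max l t / t)))) := by
  rcases le_total t l with h | h
  · rw [max_eq_left h]
    have h1 : exp (-(1 / 2 * log (l / t))) * √(l / t) = 1 := by
      rw [sqrt_eq_rpow, rpow_def_of_pos (by positivity), ← exp_add]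
      simp; ring
    have h2 := lintegral_channelDensity_mul hl ht a (fun _ => 1)
    simp only [mul_one, lintegral_one, measure_univ] at h2
    rw [← mul_one (ENNReal.ofReal (exp (-(1 / 2 * log (l / t))))), ← h2,
      ← lintegral_const_mul _ (by unfold channelDensity; fun_prop)]
    refine lintegral_mono fun x => ?_
    rw [← ENNReal.ofReal_mul (by positivity), channelDensity, ← mul_assoc, h1, one_mul]
  · rw [max_eq_right h, div_self ht.ne']
    simp only [log_one, mul_zero, neg_zero, exp_zero, ENNReal.ofReal_one]
    have hm := congrFun (mgf_fun_id_gaussianReal (μ := 0) (v := l.toNNReal)) (a / t)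
    have hi := integrable_exp_mul_gaussianReal (μ := 0) (v := l.toNNReal) (a / t)
    rw [mgf] at hm
    have h1 : ∀ x : ℝ, exp (-(x - a) ^ 2 / (2 * t) + x ^ 2 / (2 * t)) =
        exp (-(a ^ 2 / (2 * t))) * exp (a / t * x) := by
      intro x; rw [← exp_add]; congr 1; field_simp; ring
    simp_rw [h1]
    rw [← ofReal_integral_eq_lintegral_ofReal (hi.const_mul _)
      (Eventually.of_forall fun x => by positivity), integral_const_mul, hm, ← exp_add,
      Real.coe_toNNReal _ hl.le]
    rw [ENNReal.ofReal_le_one, exp_le_one_iff]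
    have : -(a ^ 2 / (2 * t)) + (0 * (a / t) + l * (a / t) ^ 2 / 2) =
      - (a ^ 2 * (t - l) / (2 * t ^ 2)) := by field_simp; ring
    rw [this, neg_nonpos]
    have : 0 ≤ t - l := by linarith
    positivity

lemma lintegral_pi_prod {N : ℕ} (μ : Fin N → Measure ℝ) [∀ j, IsProbabilityMeasure (μ j)]
    (F : Fin N → ℝ → ENNReal) (hF : ∀ j, Measurable (F j)) :
    ∫⁻ x, ∏ j, F j (x j) ∂Measure.pi μ = ∏ j, ∫⁻ x, F j x ∂μ j := by
  have hind := iIndepFun_pi (μ := μ) (X := F) (fun j => (hF j).aemeasurable)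
  have h := lintegral_prod_eq_prod_lintegral_of_indepFun Finset.univ _ hind
    (fun j => (hF j).comp (measurable_pi_apply j))
  rw [h]
  refine Finset.prod_congr rfl fun j _ => ?_
  exact (measurePreserving_eval μ j).lintegral_comp (hF j)

end GaussianIntegrals

section MinDist

variable {H : Type*} [NormedAddCommGroup H]

/-- The squared distance of `x` to the codebook `α`. -/
noncomputable def sqDist (α : Finset H) (x : H) : ℝ :=
  sInf ((fun a => ‖x - a‖ ^ 2) '' (α : Set H))

lemma sqDist_le {α : Finset H} {a : H} (ha : a ∈ α) (x : H) : sqDist α x ≤ ‖x - a‖ ^ 2 :=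
  csInf_le ((α.finite_toSet.image _).bddBelow) ⟨a, ha, rfl⟩

lemma exists_sqDist_eq {α : Finset H} (hα : α.Nonempty) (x : H) :
    ∃ a ∈ α, sqDist α x = ‖x - a‖ ^ 2 := by
  have h : sqDist α x ∈ (fun a => ‖x - a‖ ^ 2) '' (α : Set H) :=
    (Set.Nonempty.image _ hα).csInf_mem (α.finite_toSet.image _)
  obtain ⟨a, ha, h⟩ := h
  exact ⟨a, ha, h.symm⟩

lemma sqDist_nonneg (α : Finset H) (x : H) : 0 ≤ sqDist α x := by
  refine Real.sInf_nonneg ?_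
  rintro _ ⟨a, -, rfl⟩
  positivity

lemma continuous_sqDist {α : Finset H} (hα : α.Nonempty) : Continuous (sqDist α) := by
  have h : sqDist α = fun x => α.inf' hα fun a => ‖x - a‖ ^ 2 := by
    ext x
    rw [Finset.inf'_eq_csInf_image]; rfl
  rw [h]
  exact Continuous.finset_inf'_apply hα fun a _ => by fun_prop

lemma integrable_sqDist {Ω : Type*} [MeasurableSpace Ω] {P : Measure Ω} [IsFiniteMeasure P]
    {X : Ω → H} (hX : AEStronglyMeasurable X P) (hXint : Integrable (fun ω => ‖X ω‖ ^ 2) P)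
    {α : Finset H} (hα : α.Nonempty) : Integrable (fun ω => sqDist α (X ω)) P := by
  obtain ⟨a, ha⟩ := hα
  have h2 : MemLp X 2 P := (memLp_two_iff_integrable_sq_norm hX).2 hXint
  have h3 := (h2.sub (memLp_const a)).integrable_norm_pow two_ne_zero
  refine h3.mono' ((continuous_sqDist ⟨a, ha⟩).comp_aestronglyMeasurable hX)
    (Eventually.of_forall fun ω => ?_)
  rw [Real.norm_of_nonneg (sqDist_nonneg _ _)]
  exact sqDist_le ha _

end MinDist

section ShannonLowerBound

variable {H : Type*} [NormedAddCommGroup H] [InnerProductSpace ℝ H]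
  {Ω : Type*} [MeasurableSpace Ω] {P : Measure Ω} {X : Ω → H}
  {u : ℕ → H} {lam : ℕ → ℝ}

lemma integral_coord_sq (hu : Orthonormal ℝ u)
    (heig : ∀ j, ∀ y : H, ∫ ω, ⟪u j, X ω⟫ * ⟪y, X ω⟫ ∂P = lam j * ⟪u j, y⟫) (j : ℕ) :
    ∫ ω, ⟪u j, X ω⟫ ^ 2 ∂P = lam j := by
  have h2 := heig j (u j)
  simp only [real_inner_self_eq_norm_sq, hu.1 j] at h2
  simpa [pow_two] using h2

lemma sum_coord_sub_sq_le (hu : Orthonormal ℝ u) (N : ℕ) (x a : H) :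
    ∑ j : Fin N, (⟪u j, x⟫ - ⟪u j, a⟫) ^ 2 ≤ ‖x - a‖ ^ 2 := by
  have h := (hu.comp _ (Fin.val_injective (n := N))).sum_inner_products_le (x - a)
    (s := Finset.univ)
  simpa [inner_sub_right, Function.comp] using h

/-- The Shannon lower bound for the mean squared distance to a finite codebook. -/
lemma shannon_lower_bound [IsProbabilityMeasure P]
    (hXmeas : AEStronglyMeasurable X P) (hXint : Integrable (fun ω => ‖X ω‖ ^ 2) P)
    (hGauss : ∀ y : H, ∃ v : ℝ≥0, Measure.map (fun ω => ⟪y, X ω⟫) P = gaussianReal 0 v)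
    (hu : Orthonormal ℝ u) (hlam : ∀ j, 0 < lam j)
    (heig : ∀ j, ∀ y : H, ∫ ω, ⟪u j, X ω⟫ * ⟪y, X ω⟫ ∂P = lam j * ⟪u j, y⟫)
    (N : ℕ) {t : ℝ} (ht : 0 < t) {α : Finset H} (hα : α.Nonempty) {n : ℕ} (hn : α.card ≤ n) :
    ∑ j : Fin N, min (lam j) t +
        2 * t * (∑ j : Fin N, 1 / 2 * log (max (lam j) t / t) - log n) ≤
      ∫ ω, sqDist α (X ω) ∂P := by
  set R : ℝ := ∑ j : Fin N, 1 / 2 * log (max (lam j) t / t) with hR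
  have hn0 : (0 : ℝ) < n := by exact_mod_cast hα.card_pos.trans_le hn
  have hmax : ∀ j, 0 < max (lam j) t := fun j => lt_max_of_lt_right ht
  set E : H → Ω → ℝ := fun a ω =>
    ∑ j : Fin N, (-(⟪u j, X ω⟫ - ⟪u j, a⟫) ^ 2 / (2 * t) + ⟪u j, X ω⟫ ^ 2 / (2 * max (lam j) t))
    with hE
  have hlE : ∀ a, ∫⁻ ω, ENNReal.ofReal (exp (E a ω)) ∂P ≤ ENNReal.ofReal (exp (-R)) := by
    intro a
    have hm : AEMeasurable (fun ω (j : Fin N) => ⟪u j, X ω⟫) P :=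
      aemeasurable_pi_lambda _ fun j => aemeasurable_inner_of_gaussian hGauss _
    have h1 := lintegral_pi_prod (fun j : Fin N => gaussianReal 0 (lam j).toNNReal)
      (fun j x => ENNReal.ofReal
        (exp (-(x - ⟪u j, a⟫) ^ 2 / (2 * t) + x ^ 2 / (2 * max (lam j) t))))
      (fun j => by fun_prop)
    rw [← map_coords_eq_pi hGauss hu heig, lintegral_map' (by fun_prop) hm] at h1
    calc ∫⁻ ω, ENNReal.ofReal (exp (E a ω)) ∂P
        = _ := by
          refine (lintegral_congr fun ω => ?_).trans h1
          rw [hE, exp_sum, ENNReal.ofReal_prod_of_nonneg fun j _ => (exp_pos _).le]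
      _ ≤ ∏ j : Fin N, ENNReal.ofReal (exp (-(1 / 2 * log (max (lam j) t / t)))) :=
          Finset.prod_le_prod' fun j _ => lintegral_exp_shift_le (hlam j) ht _
      _ = _ := by
          rw [← ENNReal.ofReal_prod_of_nonneg fun j _ => (exp_pos _).le, ← exp_sum,
            Finset.sum_neg_distrib]
  set Z : Ω → ℝ := fun ω => -(sqDist α (X ω) / (2 * t)) +
    ∑ j : Fin N, ⟪u j, X ω⟫ ^ 2 / (2 * max (lam j) t) + (R - log n) with hZ
  have hi1 : Integrable (fun ω => -(sqDist α (X ω) / (2 * t))) P :=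
    ((integrable_sqDist hXmeas hXint hα).div_const _).neg
  have hi2 : ∀ j ∈ (Finset.univ : Finset (Fin N)),
      Integrable (fun ω => ⟪u j, X ω⟫ ^ 2 / (2 * max (lam j) t)) P := fun j _ =>
    (memLp_inner_of_gaussian hGauss _).integrable_sq.div_const _
  have hi3 : Integrable (fun ω => -(sqDist α (X ω) / (2 * t)) +
    ∑ j : Fin N, ⟪u j, X ω⟫ ^ 2 / (2 * max (lam j) t)) P := hi1.add (integrable_finsetSum _ hi2)
  have hZi : Integrable Z P := hi3.add (integrable_const _)
  have hZE : ∀ ω, exp (Z ω) ≤ ∑ a ∈ α, exp (R - log n) * exp (E a ω) := by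
    intro ω
    obtain ⟨a, ha, hd⟩ := exists_sqDist_eq hα (X ω)
    refine le_trans ?_ (Finset.single_le_sum
      (f := fun a => exp (R - log n) * exp (E a ω)) (fun a _ => by positivity) ha)
    rw [← exp_add, exp_le_exp]
    simp only [hZ, hE, Finset.sum_add_distrib, hd]
    have hb := sum_coord_sub_sq_le hu N (X ω) a
    have : ∑ j : Fin N, -(⟪u j, X ω⟫ - ⟪u j, a⟫) ^ 2 / (2 * t) =
        -((∑ j : Fin N, (⟪u j, X ω⟫ - ⟪u j, a⟫) ^ 2) / (2 * t)) := by
      rw [← Finset.sum_div, Finset.sum_neg_distrib, neg_div]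
    rw [this]
    have := div_le_div_of_nonneg_right hb (by positivity : 0 ≤ 2 * t)
    linarith
  have hlZ : ∫⁻ ω, ENNReal.ofReal (exp (Z ω)) ∂P ≤ 1 := by
    have hmE : ∀ a, AEMeasurable (fun ω => ENNReal.ofReal (exp (E a ω))) P := by
      intro a
      have : ∀ j : Fin N, AEMeasurable (fun ω => ⟪u j, X ω⟫) P :=
        fun j => aemeasurable_inner_of_gaussian hGauss _
      refine (measurable_exp.comp_aemeasurable ?_).ennreal_ofReal
      exact Finset.aemeasurable_fun_sum _ fun j _ =>
        ((((this j).sub_const _).pow_const 2).neg.div_const _).add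
          (((this j).pow_const 2).div_const _)
    calc ∫⁻ ω, ENNReal.ofReal (exp (Z ω)) ∂P
        ≤ ∫⁻ ω, ∑ a ∈ α, ENNReal.ofReal (exp (R - log n)) * ENNReal.ofReal (exp (E a ω)) ∂P := by
          refine lintegral_mono fun ω => ?_
          refine (ENNReal.ofReal_le_ofReal (hZE ω)).trans ?_
          rw [ENNReal.ofReal_sum_of_nonneg fun a _ => by positivity]
          exact Finset.sum_le_sum fun a _ => (ENNReal.ofReal_mul (by positivity)).le
      _ = ∑ a ∈ α, ENNReal.ofReal (exp (R - log n)) * ∫⁻ ω, ENNReal.ofReal (exp (E a ω)) ∂P := by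
          rw [lintegral_finsetSum' _ fun a _ => (hmE a).const_mul _]
          exact Finset.sum_congr rfl fun a _ => lintegral_const_mul'' _ (hmE a)
      _ ≤ ∑ a ∈ α, ENNReal.ofReal (exp (R - log n)) * ENNReal.ofReal (exp (-R)) :=
          Finset.sum_le_sum fun a _ => by gcongr; exact hlE a
      _ = ENNReal.ofReal (α.card * (n : ℝ)⁻¹) := by
          rw [Finset.sum_const, ← ENNReal.ofReal_mul (by positivity), ← exp_add,
            nsmul_eq_mul, ENNReal.ofReal_mul (by positivity), ENNReal.ofReal_natCast]
          congr 3
          rw [show R - log n + -R = -log n by ring, exp_neg, exp_log hn0]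
      _ ≤ 1 := by
          rw [ENNReal.ofReal_le_one, ← div_eq_mul_inv, div_le_one hn0]
          exact_mod_cast hn
  have hexp : Integrable (fun ω => exp (Z ω)) P := by
    refine ⟨(continuous_exp.comp_aestronglyMeasurable hZi.1), ?_⟩
    rw [hasFiniteIntegral_iff_ofReal (Eventually.of_forall fun ω => (exp_pos _).le)]
    exact hlZ.trans_lt ENNReal.one_lt_top
  have hle1 : ∫ ω, exp (Z ω) ∂P ≤ 1 := by
    rw [integral_eq_lintegral_of_nonneg_ae (Eventually.of_forall fun ω => (exp_pos _).le) hexp.1]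
    exact ENNReal.toReal_le_of_le_ofReal zero_le_one (by simpa using hlZ)
  have hle2 : ∫ ω, (Z ω + 1) ∂P ≤ ∫ ω, exp (Z ω) ∂P :=
    integral_mono (hZi.add (integrable_const _)) hexp fun ω => add_one_le_exp _
  have hZint : ∫ ω, Z ω ∂P = -((∫ ω, sqDist α (X ω) ∂P) / (2 * t)) +
      ∑ j : Fin N, min (lam j) t / (2 * t) + (R - log n) := by
    simp only [hZ]
    rw [integral_add hi3 (integrable_const _), integral_add hi1 (integrable_finsetSum _ hi2),
      integral_neg, integral_div, integral_finsetSum _ hi2]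
    simp only [integral_div, integral_coord_sq hu heig, integral_const, probReal_univ, one_smul]
    congr 2
    refine Finset.sum_congr rfl fun j _ => ?_
    rw [div_eq_div_iff (by have := hmax j; positivity) (by positivity)]
    have := min_mul_max (lam j) t
    linear_combination (-2) * this
  rw [integral_add hZi (integrable_const _)] at hle2
  simp only [integral_const, probReal_univ, one_smul] at hle2
  rw [hZint, ← Finset.sum_div] at hle2
  have h3 : -((∫ ω, sqDist α (X ω) ∂P) / (2 * t)) +
      (∑ j : Fin N, min (lam j) t) / (2 * t) + (R - log n) ≤ 0 := by linarith
  have h4 := mul_nonpos_of_nonneg_of_nonpos (by positivity : 0 ≤ 2 * t) h3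
  field_simp at h4
  nlinarith [h4]

end ShannonLowerBound

section RandomCoding

variable {A B : Type*} [MeasurableSpace A] [MeasurableSpace B]

/-- Codewords drawn at random from `ν` miss `x` with probability `ν {y | (x, y) ∉ G} ^ n`, so some
deterministic codebook does at least as well on average. -/
lemma exists_codebook (μ : Measure A) [SFinite μ] (ν : Measure B) [IsProbabilityMeasure ν]
    {G : Set (A × B)} (hG : MeasurableSet G) (n : ℕ) (W : A → ENNReal) (hW : Measurable W) :
    ∃ c : Fin n → B, ∫⁻ x in {x | ∀ i, (x, c i) ∉ G}, W x ∂μ ≤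
      ∫⁻ x, W x * ν {y | (x, y) ∉ G} ^ n ∂μ := by
  induction n generalizing W with
  | zero => exact ⟨Fin.elim0, by simp⟩
  | succ n ih =>
    have hV : Measurable fun x => ν {y | (x, y) ∉ G} :=
      measurable_measure_prodMk_left hG.compl
    set g : A → B → ENNReal := fun x y =>
      W x * ν {y | (x, y) ∉ G} ^ n * Gᶜ.indicator 1 (x, y) with hg
    have hgm : Measurable (Function.uncurry g) := by
      have h1 : Measurable fun p : A × B => W p.1 * ν {y | (p.1, y) ∉ G} ^ n :=
        (hW.comp measurable_fst).mul ((hV.comp measurable_fst).pow_const n)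
      exact h1.mul ((measurable_one).indicator hG.compl)
    have hgm' : Measurable fun y => ∫⁻ x, g x y ∂μ := hgm.lintegral_prod_left
    obtain ⟨y, hy⟩ := exists_le_lintegral (μ := ν) hgm'.aemeasurable
    have hS : MeasurableSet {x | (x, y) ∉ G} := (measurable_prodMk_right (y := y)) hG.compl
    rw [lintegral_lintegral_swap (by exact (hgm.comp measurable_swap).aemeasurable)] at hy
    have hin : ∀ x, ∫⁻ y, g x y ∂ν = W x * ν {y | (x, y) ∉ G} ^ (n + 1) := by
      intro x
      have hs : MeasurableSet {y | (x, y) ∉ G} := (measurable_prodMk_left (x := x)) hG.compl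
      simp only [hg]
      have hm : Measurable fun y => Gᶜ.indicator (1 : A × B → ENNReal) (x, y) :=
        (measurable_one.indicator hG.compl).comp measurable_prodMk_left
      rw [lintegral_const_mul _ hm, pow_succ, ← mul_assoc]
      congr 1
      exact lintegral_indicator_one hs
    simp_rw [hin] at hy
    obtain ⟨c, hc⟩ := ih ({x | (x, y) ∉ G}.indicator W) (hW.indicator hS)
    refine ⟨Fin.cons y c, le_trans (le_of_eq ?_) (hc.trans (le_trans (le_of_eq ?_) hy))⟩
    · rw [lintegral_indicator hS, Measure.restrict_restrict hS]
      congr 2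
      ext x
      simp [Fin.forall_fin_succ]
    · refine lintegral_congr fun x => ?_
      simp only [hg]
      by_cases hx : (x, y) ∈ G <;> simp [hx]

/-- The probability of missing `x` with `n` codewords, in terms of an upper bound `exp t` of the
density of the joint law on the good set `G`. -/
lemma miss_probability_le (ν : Measure B) [IsProbabilityMeasure ν] {G : Set B}
    (hG : MeasurableSet G) {f : B → ENNReal} (hf1 : ∫⁻ y, f y ∂ν = 1) {t : ℝ}
    (hft : ∀ y ∈ G, f y ≤ ENNReal.ofReal (exp t)) (n : ℕ) :
    ν Gᶜ ^ n ≤ ∫⁻ y in Gᶜ, f y ∂ν + ENNReal.ofReal (exp (-(n * exp (-t)))) := by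
  set p : ℝ := (ν G).toReal
  set q : ℝ := (∫⁻ y in G, f y ∂ν).toReal
  have hsum : ∫⁻ y in G, f y ∂ν + ∫⁻ y in Gᶜ, f y ∂ν = 1 := by
    rw [lintegral_add_compl _ hG, hf1]
  have hq1 : ∫⁻ y in G, f y ∂ν ≤ 1 := hsum ▸ le_self_add
  have hqt : ∫⁻ y in G, f y ∂ν ≠ ⊤ := (hq1.trans_lt ENNReal.one_lt_top).ne
  have hq : ∫⁻ y in Gᶜ, f y ∂ν = ENNReal.ofReal (1 - q) := by
    rw [ENNReal.ofReal_sub _ ENNReal.toReal_nonneg, ENNReal.ofReal_toReal hqt, ENNReal.ofReal_one]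
    exact ENNReal.eq_sub_of_add_eq hqt (by rw [add_comm, hsum])
  have hp : ν Gᶜ = ENNReal.ofReal (1 - p) := by
    rw [ENNReal.ofReal_sub _ ENNReal.toReal_nonneg, ENNReal.ofReal_toReal (measure_ne_top _ _),
      ENNReal.ofReal_one, prob_compl_eq_one_sub hG]
  have hp1 : p ≤ 1 := measureReal_le_one (μ := ν) (s := G)
  have hq1' : q ≤ 1 := ENNReal.toReal_le_of_le_ofReal zero_le_one (by simpa using hq1)
  have hq0 : 0 ≤ q := ENNReal.toReal_nonneg
  have hqp : q ≤ exp t * p := by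
    refine ENNReal.toReal_le_of_le_ofReal (by positivity) ?_
    rw [ENNReal.ofReal_mul (by positivity), ENNReal.ofReal_toReal (measure_ne_top _ _)]
    exact (setLIntegral_mono measurable_const hft).trans_eq (by simp)
  rw [hp, hq, ← ENNReal.ofReal_pow (by linarith),
    ← ENNReal.ofReal_add (by linarith) (by positivity)]
  refine ENNReal.ofReal_le_ofReal ?_
  set a : ℝ := n * exp (-t) with ha
  have hpe : exp (-t) * q ≤ p := by
    have := mul_le_mul_of_nonneg_left hqp (exp_pos (-t)).le
    rwa [← mul_assoc, ← exp_add, neg_add_cancel, exp_zero, one_mul] at this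
  have h1 : (1 - p) ^ n ≤ exp (-(a * q)) := by
    calc (1 - p) ^ n ≤ (exp (-p)) ^ n :=
          pow_le_pow_left₀ (by linarith) (one_sub_le_exp_neg p) n
      _ = exp (-(n * p)) := by rw [← exp_nat_mul]; congr 1; ring
      _ ≤ _ := by
          rw [exp_le_exp, neg_le_neg_iff, ha, mul_assoc]
          exact mul_le_mul_of_nonneg_left hpe (by positivity)
  have h2 : exp (-(a * q)) ≤ (1 - q) + q * exp (-a) := by
    have := convexOn_exp.2 (Set.mem_univ 0) (Set.mem_univ (-a)) (by linarith : 0 ≤ 1 - q) hq0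
      (by ring)
    simp only [smul_eq_mul, mul_zero, exp_zero, mul_one, zero_add] at this
    rwa [show q * -a = -(a * q) by ring] at this
  have h3 : q * exp (-a) ≤ exp (-a) := mul_le_of_le_one_left (exp_pos _).le hq1'
  linarith

lemma lintegral_pi_pi_prod {m : ℕ} (μ ν : Fin m → Measure ℝ) [∀ j, IsProbabilityMeasure (μ j)]
    [∀ j, IsProbabilityMeasure (ν j)] (F : Fin m → ℝ → ℝ → ENNReal)
    (hF : ∀ j, Measurable (Function.uncurry (F j))) :
    ∫⁻ x, ∫⁻ y, ∏ j, F j (x j) (y j) ∂Measure.pi ν ∂Measure.pi μ =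
      ∏ j, ∫⁻ x, ∫⁻ y, F j x y ∂ν j ∂μ j := by
  rw [← lintegral_pi_prod μ (fun j x => ∫⁻ y, F j x y ∂ν j)
    fun j => (hF j).lintegral_prod_right]
  refine lintegral_congr fun x => ?_
  exact lintegral_pi_prod ν (fun j => F j (x j)) fun j => (hF j).comp measurable_prodMk_left

lemma exists_chernoff_exponents {ε : ℝ} (h0 : 0 < ε) (h1 : ε < 1) :
    ∃ ρ s s' : ℝ, 0 < ρ ∧ ρ < 1 ∧ 0 < s ∧ s < 1 / 2 ∧ 0 < s' ∧
      (√(1 - 2 * s))⁻¹ * exp (-(s * (1 + ε))) ≤ ρ ∧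
      (√(1 - 2 * -s'))⁻¹ * exp (s' * (1 - ε)) ≤ ρ := by
  have key : ∀ {a c : ℝ}, 0 < a → exp (2 * c) < a → (√a)⁻¹ * exp c < 1 := by
    intro a c ha h
    rw [inv_mul_lt_iff₀ (sqrt_pos.2 ha), mul_one]
    refine lt_sqrt_of_sq_lt ?_
    rwa [← exp_nat_mul]
  have hs : ε / (4 * (1 + ε)) < 1 / 2 := by
    rw [div_lt_div_iff₀ (by positivity) (by norm_num)]; linarith
  have e1 : exp (2 * -(ε / (4 * (1 + ε)) * (1 + ε))) < 1 - 2 * (ε / (4 * (1 + ε))) := by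
    have h2 : 2 * -(ε / (4 * (1 + ε)) * (1 + ε)) = -(ε / 2) := by field_simp; ring
    have h3 : 1 - 2 * (ε / (4 * (1 + ε))) = (2 + ε) / (2 * (1 + ε)) := by field_simp; ring
    rw [h2, h3, exp_neg, ← one_div, div_lt_div_iff₀ (exp_pos _) (by positivity)]
    have := add_one_le_exp (ε / 2)
    nlinarith
  have e2 : exp (2 * (ε / 2 * (1 - ε))) < 1 - 2 * -(ε / 2) := by
    have h2 : 2 * (ε / 2 * (1 - ε)) = -(-(ε * (1 - ε))) := by ring
    rw [h2, exp_neg, inv_lt_comm₀ (exp_pos _) (by linarith)]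
    refine lt_of_lt_of_le ?_ (add_one_le_exp _)
    rw [inv_lt_iff_one_lt_mul₀ (by linarith)]
    nlinarith [pow_pos h0 3]
  refine ⟨max _ _, ε / (4 * (1 + ε)), ε / 2, ?_, ?_, by positivity, hs, by positivity,
    le_max_left _ _, le_max_right _ _⟩
  · refine lt_max_of_lt_right (mul_pos (inv_pos.2 (sqrt_pos.2 (by linarith))) (exp_pos _))
  · exact max_lt (key (by linarith) e1) (key (by linarith) e2)

end RandomCoding

section GaussianCodebook

lemma lintegral_lintegral_add_left {A B : Type*} [MeasurableSpace A] [MeasurableSpace B]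
    {μ : Measure A} {ν : Measure B} [SFinite ν] {g g' : A → B → ENNReal}
    (hg : Measurable (Function.uncurry g)) :
    ∫⁻ x, ∫⁻ y, (g x y + g' x y) ∂ν ∂μ = ∫⁻ x, ∫⁻ y, g x y ∂ν ∂μ + ∫⁻ x, ∫⁻ y, g' x y ∂ν ∂μ := by
  rw [← lintegral_add_left hg.lintegral_prod_right]
  refine lintegral_congr fun x => ?_
  exact lintegral_add_left (hg.comp (measurable_prodMk_left (x := x))) _

lemma lintegral_channel_exp_error {l t s κ : ℝ} (ht : 0 < t) (htl : t ≤ l) (hs : s < 1 / 2) :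
    ∫⁻ x, ∫⁻ y, ENNReal.ofReal (channelDensity l t x y) *
        ENNReal.ofReal (exp (s * ((x - y) ^ 2 / t) + κ)) ∂gaussianReal 0 (l - t).toNNReal
        ∂gaussianReal 0 l.toNNReal = ENNReal.ofReal ((√(1 - 2 * s))⁻¹ * exp κ) := by
  have hl : 0 < l := ht.trans_le htl
  have hm : Measurable (Function.uncurry fun x y : ℝ => ENNReal.ofReal (channelDensity l t x y) *
      ENNReal.ofReal (exp (s * ((x - y) ^ 2 / t) + κ))) := by
    unfold channelDensity Function.uncurry; fun_prop
  rw [lintegral_lintegral_swap hm.aemeasurable]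
  have : ∀ y : ℝ, ∫⁻ x, ENNReal.ofReal (channelDensity l t x y) *
      ENNReal.ofReal (exp (s * ((x - y) ^ 2 / t) + κ)) ∂gaussianReal 0 l.toNNReal =
      ENNReal.ofReal ((√(1 - 2 * s))⁻¹ * exp κ) := by
    intro y
    rw [lintegral_channelDensity_mul hl ht]
    simp_rw [exp_add, ENNReal.ofReal_mul (exp_pos _).le]
    rw [lintegral_mul_const _ (by fun_prop), lintegral_exp_sq_gaussianReal ht hs,
      ENNReal.ofReal_mul (by positivity)]
  simp [this]

lemma lintegral_channel_exp_source {l t s κ : ℝ} (ht : 0 < t) (htl : t ≤ l) (hs : s < 1 / 2) :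
    ∫⁻ x, ∫⁻ y, ENNReal.ofReal (channelDensity l t x y) *
        ENNReal.ofReal (exp (s * (x ^ 2 / l) + κ)) ∂gaussianReal 0 (l - t).toNNReal
        ∂gaussianReal 0 l.toNNReal = ENNReal.ofReal ((√(1 - 2 * s))⁻¹ * exp κ) := by
  have hl : 0 < l := ht.trans_le htl
  have h := lintegral_exp_sq_gaussianReal hl hs 0
  simp only [sub_zero] at h
  rw [ENNReal.ofReal_mul (by positivity), ← h, ← lintegral_mul_const _ (by fun_prop)]
  refine lintegral_congr fun x => ?_
  rw [lintegral_mul_const _ (by unfold channelDensity; fun_prop),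
    lintegral_channelDensity_right ht htl, one_mul, exp_add, ENNReal.ofReal_mul (exp_pos _).le]

/-- Codebooks of rate slightly above `∑ 1/2 log (l j / t)` achieving distortion `t` per coordinate,
outside an event of exponentially small probability. -/
lemma exists_gaussian_codebook {ε : ℝ} (h0 : 0 < ε) (h1 : ε < 1) :
    ∃ ρ : ℝ, 0 < ρ ∧ ρ < 1 ∧ ∀ (m : ℕ) (l : Fin m → ℝ) (t : ℝ), 0 < t → (∀ j, t ≤ l j) →
      ∀ n : ℕ, exp (∑ j, 1 / 2 * log (l j / t) + 2 * ε * m) ≤ n →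
      ∃ c : Fin n → Fin m → ℝ, (Measure.pi fun j => gaussianReal 0 (l j).toNNReal)
        {x | ∀ i, m * t * (1 + ε) < ∑ j, (x j - c i j) ^ 2} ≤ ENNReal.ofReal (4 * ρ ^ m) := by
  obtain ⟨ρ, s, s', hρ0, hρ1, hs0, hs1, hs', hρs, hρs'⟩ := exists_chernoff_exponents h0 h1
  refine ⟨max ρ (exp (-ε)), lt_max_of_lt_left hρ0, max_lt hρ1 (by simpa using h0), ?_⟩
  intro m l t ht htl n hn
  have hl : ∀ j, 0 < l j := fun j => ht.trans_le (htl j)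
  set μ := Measure.pi fun j => gaussianReal 0 (l j).toNNReal with hμ
  set ν := Measure.pi fun j => gaussianReal 0 (l j - t).toNNReal with hν
  set R : ℝ := ∑ j, 1 / 2 * log (l j / t) with hR
  set G : Set ((Fin m → ℝ) × (Fin m → ℝ)) := {p | ∑ j, (p.1 j - p.2 j) ^ 2 / t ≤ m * (1 + ε) ∧
    m * (1 - ε) ≤ ∑ j, (p.1 j - p.2 j) ^ 2 / t ∧ ∑ j, p.1 j ^ 2 / l j ≤ m * (1 + ε)} with hGdef
  have hG : MeasurableSet G := by
    have hd : Measurable fun p : (Fin m → ℝ) × (Fin m → ℝ) => ∑ j, (p.1 j - p.2 j) ^ 2 / t := by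
      fun_prop
    have hx : Measurable fun p : (Fin m → ℝ) × (Fin m → ℝ) => ∑ j, p.1 j ^ 2 / l j := by
      fun_prop
    exact (measurableSet_le hd measurable_const).inter
      ((measurableSet_le measurable_const hd).inter (measurableSet_le hx measurable_const))
  set f : (Fin m → ℝ) → (Fin m → ℝ) → ENNReal := fun x y =>
    ∏ j, ENNReal.ofReal (channelDensity (l j) t (x j) (y j)) with hf
  have hf1 : ∀ x, ∫⁻ y, f x y ∂ν = 1 := by
    intro x
    rw [hν, lintegral_pi_prod _ (fun j y => ENNReal.ofReal (channelDensity (l j) t (x j) y))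
      fun j => by unfold channelDensity; fun_prop]
    exact Finset.prod_eq_one fun j _ => lintegral_channelDensity_right ht (htl j) _
  have hft : ∀ x y, (x, y) ∈ G → f x y ≤ ENNReal.ofReal (exp (R + ε * m)) := by
    rintro x y ⟨-, h2, h3⟩
    simp only at h2 h3
    simp only [hf]
    rw [← ENNReal.ofReal_prod_of_nonneg fun j _ => channelDensity_nonneg _ _ _ _]
    refine ENNReal.ofReal_le_ofReal ?_
    have : ∀ j, channelDensity (l j) t (x j) (y j) = exp (1 / 2 * log (l j / t) -
        (1 / 2) * ((x j - y j) ^ 2 / t) + (1 / 2) * (x j ^ 2 / l j)) := by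
      intro j
      have hp : 0 < l j / t := div_pos (hl j) ht
      rw [channelDensity, sqrt_eq_rpow, rpow_def_of_pos hp, ← exp_add]
      congr 1
      have := (hl j).ne'
      field_simp
      ring
    simp_rw [this]
    rw [← exp_sum, exp_le_exp, Finset.sum_add_distrib, Finset.sum_sub_distrib, ← Finset.mul_sum,
      ← Finset.mul_sum, ← Finset.mul_sum]
    rw [hR, ← Finset.mul_sum]
    linarith
  have hbad : ∫⁻ x, ∫⁻ y in {y | (x, y) ∈ G}ᶜ, f x y ∂ν ∂μ ≤ ENNReal.ofReal (3 * ρ ^ m) := by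
    set e₁ : Fin m → ℝ → ℝ → ENNReal := fun j x y => ENNReal.ofReal (channelDensity (l j) t x y) *
      ENNReal.ofReal (exp (s * ((x - y) ^ 2 / t) + -(s * (1 + ε)))) with he₁
    set e₂ : Fin m → ℝ → ℝ → ENNReal := fun j x y => ENNReal.ofReal (channelDensity (l j) t x y) *
      ENNReal.ofReal (exp (-s' * ((x - y) ^ 2 / t) + s' * (1 - ε))) with he₂
    set e₃ : Fin m → ℝ → ℝ → ENNReal := fun j x y => ENNReal.ofReal (channelDensity (l j) t x y) *
      ENNReal.ofReal (exp (s * (x ^ 2 / l j) + -(s * (1 + ε)))) with he₃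
    have hm₁ : ∀ j, Measurable (Function.uncurry (e₁ j)) := fun j => by
      simp only [he₁, channelDensity]; fun_prop
    have hm₂ : ∀ j, Measurable (Function.uncurry (e₂ j)) := fun j => by
      simp only [he₂, channelDensity]; fun_prop
    have hm₃ : ∀ j, Measurable (Function.uncurry (e₃ j)) := fun j => by
      simp only [he₃, channelDensity]; fun_prop
    have hM : ∀ e : Fin m → ℝ → ℝ → ENNReal, (∀ j, Measurable (Function.uncurry (e j))) →
        Measurable (Function.uncurry fun x y : Fin m → ℝ => ∏ j, e j (x j) (y j)) := by
      intro e he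
      refine Finset.measurable_fun_prod _ fun j _ => ?_
      exact (he j).comp (g := Function.uncurry (e j))
        (f := fun p : (Fin m → ℝ) × (Fin m → ℝ) => (p.1 j, p.2 j)) (by fun_prop)
    have hI : ∀ e : Fin m → ℝ → ℝ → ENNReal, (∀ j, Measurable (Function.uncurry (e j))) →
        (∀ j, ∫⁻ x, ∫⁻ y, e j x y ∂gaussianReal 0 (l j - t).toNNReal ∂gaussianReal 0 (l j).toNNReal
          ≤ ENNReal.ofReal ρ) →
        ∫⁻ x, ∫⁻ y, ∏ j, e j (x j) (y j) ∂ν ∂μ ≤ ENNReal.ofReal (ρ ^ m) := by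
      intro e he hle
      rw [hμ, hν, lintegral_pi_pi_prod _ _ _ he]
      refine (Finset.prod_le_prod' fun j _ => hle j).trans_eq ?_
      simp [ENNReal.ofReal_pow hρ0.le]
    have hpt : ∀ x y, (x, y) ∉ G → f x y ≤
        ∏ j, e₁ j (x j) (y j) + ∏ j, e₂ j (x j) (y j) + ∏ j, e₃ j (x j) (y j) := by
      intro x y hxy
      have hone : ∀ w : Fin m → ℝ, 0 ≤ ∑ j, w j → f x y ≤
          ∏ j, (ENNReal.ofReal (channelDensity (l j) t (x j) (y j)) *
            ENNReal.ofReal (exp (w j))) := by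
        intro w hw
        rw [Finset.prod_mul_distrib, ← ENNReal.ofReal_prod_of_nonneg fun j _ => (exp_pos _).le,
          ← exp_sum]
        refine le_mul_of_one_le_right' ?_
        rw [ENNReal.one_le_ofReal]
        exact one_le_exp hw
      simp only [hGdef, Set.mem_ofPred_eq, not_and_or, not_le] at hxy
      rcases hxy with h | h | h
      · refine (hone _ ?_).trans (le_self_add.trans le_self_add)
        rw [Finset.sum_add_distrib, ← Finset.mul_sum]
        simp only [Finset.sum_const, Finset.card_univ, Fintype.card_fin, nsmul_eq_mul]
        nlinarith
      · refine (hone _ ?_).trans (le_add_self.trans le_self_add)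
        rw [Finset.sum_add_distrib, ← Finset.mul_sum]
        simp only [Finset.sum_const, Finset.card_univ, Fintype.card_fin, nsmul_eq_mul]
        nlinarith
      · refine (hone _ ?_).trans le_add_self
        rw [Finset.sum_add_distrib, ← Finset.mul_sum]
        simp only [Finset.sum_const, Finset.card_univ, Fintype.card_fin, nsmul_eq_mul]
        nlinarith
    calc ∫⁻ x, ∫⁻ y in {y | (x, y) ∈ G}ᶜ, f x y ∂ν ∂μ
        ≤ ∫⁻ x, ∫⁻ y, (∏ j, e₁ j (x j) (y j) + ∏ j, e₂ j (x j) (y j) + ∏ j, e₃ j (x j) (y j))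
            ∂ν ∂μ := by
          refine lintegral_mono fun x => ?_
          refine (setLIntegral_mono' ?_ fun y hy => hpt x y hy).trans
            (setLIntegral_le_lintegral _ _)
          exact ((measurable_prodMk_left (x := x)) hG).compl
      _ = ∫⁻ x, ∫⁻ y, ∏ j, e₁ j (x j) (y j) ∂ν ∂μ + ∫⁻ x, ∫⁻ y, ∏ j, e₂ j (x j) (y j) ∂ν ∂μ +
            ∫⁻ x, ∫⁻ y, ∏ j, e₃ j (x j) (y j) ∂ν ∂μ := by
          have h1 := hM e₁ hm₁
          have h2 := hM e₂ hm₂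
          rw [← lintegral_lintegral_add_left h1, ← lintegral_lintegral_add_left (h1.add h2)]
      _ ≤ ENNReal.ofReal (ρ ^ m) + ENNReal.ofReal (ρ ^ m) + ENNReal.ofReal (ρ ^ m) := by
          refine add_le_add (add_le_add ?_ ?_) ?_
          · refine hI e₁ hm₁ fun j => ?_
            rw [he₁, lintegral_channel_exp_error ht (htl j) hs1]
            exact ENNReal.ofReal_le_ofReal hρs
          · refine hI e₂ hm₂ fun j => ?_
            rw [he₂, lintegral_channel_exp_error ht (htl j) (by linarith)]
            exact ENNReal.ofReal_le_ofReal hρs'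
          · refine hI e₃ hm₃ fun j => ?_
            rw [he₃, lintegral_channel_exp_source ht (htl j) hs1]
            exact ENNReal.ofReal_le_ofReal hρs
      _ = ENNReal.ofReal (3 * ρ ^ m) := by
          have : 0 ≤ ρ ^ m := by positivity
          rw [← ENNReal.ofReal_add this this, ← ENNReal.ofReal_add (by positivity) this]
          congr 1; ring
  obtain ⟨c, hc⟩ := exists_codebook μ ν hG n 1 measurable_one
  refine ⟨c, ?_⟩
  have hsub : {x : Fin m → ℝ | ∀ i, m * t * (1 + ε) < ∑ j, (x j - c i j) ^ 2} ⊆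
      {x | ∀ i, (x, c i) ∉ G} := by
    intro x hx i hi
    have h2 := hi.1
    simp only at h2
    rw [← Finset.sum_div, div_le_iff₀ ht] at h2
    have := hx i
    nlinarith
  have hlast : ENNReal.ofReal (exp (-(n * exp (-(R + ε * m))))) ≤
      ENNReal.ofReal (exp (-ε) ^ m) := by
    refine ENNReal.ofReal_le_ofReal ?_
    rw [← exp_nat_mul, exp_le_exp]
    have h2 : exp (ε * m) ≤ n * exp (-(R + ε * m)) := by
      refine le_trans (le_of_eq ?_) (mul_le_mul_of_nonneg_right hn (exp_pos _).le)
      rw [← exp_add]; congr 1; ring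
    have := add_one_le_exp (ε * m)
    linarith
  have hρ' : ρ ^ m ≤ max ρ (exp (-ε)) ^ m := pow_le_pow_left₀ hρ0.le (le_max_left _ _) m
  have he' : exp (-ε) ^ m ≤ max ρ (exp (-ε)) ^ m :=
    pow_le_pow_left₀ (exp_pos _).le (le_max_right _ _) m
  calc μ {x | ∀ i, m * t * (1 + ε) < ∑ j, (x j - c i j) ^ 2}
      ≤ μ {x | ∀ i, (x, c i) ∉ G} := measure_mono hsub
    _ ≤ ∫⁻ x, ν {y | (x, y) ∉ G} ^ n ∂μ := by simpa using hc
    _ ≤ ∫⁻ x, (∫⁻ y in {y | (x, y) ∈ G}ᶜ, f x y ∂ν +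
          ENNReal.ofReal (exp (-(n * exp (-(R + ε * m)))))) ∂μ := by
        refine lintegral_mono fun x => ?_
        exact miss_probability_le ν ((measurable_prodMk_left (x := x)) hG) (hf1 x)
          (fun y hy => hft x y hy) n
    _ ≤ ENNReal.ofReal (3 * ρ ^ m) + ENNReal.ofReal (exp (-ε) ^ m) := by
        rw [lintegral_add_right _ measurable_const]
        refine add_le_add hbad ?_
        simpa using hlast
    _ ≤ _ := by
        rw [← ENNReal.ofReal_add (by positivity) (by positivity)]
        exact ENNReal.ofReal_le_ofReal (by linarith)

end GaussianCodebook

section UpperBound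

variable {H : Type*} [NormedAddCommGroup H] [InnerProductSpace ℝ H]
  {Ω : Type*} [MeasurableSpace Ω] {P : Measure Ω} {X : Ω → H}
  {u : ℕ → H} {lam : ℕ → ℝ}

lemma norm_sub_sum_smul_sq (hu : Orthonormal ℝ u) {m : ℕ} (c : Fin m → ℝ) (x : H) :
    ‖x - ∑ j : Fin m, c j • u j‖ ^ 2 =
      ‖x‖ ^ 2 - ∑ j : Fin m, ⟪u j, x⟫ ^ 2 + ∑ j : Fin m, (⟪u j, x⟫ - c j) ^ 2 := by
  have hv : Orthonormal ℝ fun j : Fin m => u j := hu.comp _ Fin.val_injective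
  have h1 : ‖∑ j : Fin m, c j • u j‖ ^ 2 = ∑ j, c j ^ 2 := by
    rw [← real_inner_self_eq_norm_sq, sum_inner]
    refine Finset.sum_congr rfl fun j _ => ?_
    rw [inner_smul_left, hv.inner_right_fintype]
    simp [pow_two]
  rw [norm_sub_sq_real, h1, inner_sum]
  simp_rw [inner_smul_right, real_inner_comm (u _) x, sub_sq, Finset.sum_add_distrib,
    Finset.sum_sub_distrib, Finset.mul_sum]
  have : ∑ j : Fin m, 2 * (c j * ⟪u j, x⟫) = ∑ j : Fin m, 2 * ⟪u j, x⟫ * c j :=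
    Finset.sum_congr rfl fun j _ => by ring
  rw [this]; ring

lemma integral_pow_four_gaussianReal {l : ℝ} (hl : 0 ≤ l) :
    ∫ x, x ^ 4 ∂gaussianReal 0 l.toNNReal = l ^ 2 * ∫ x, x ^ 4 ∂gaussianReal 0 1 := by
  have h := gaussianReal_map_const_mul (μ := 0) (v := 1) (√l)
  have h2 : NNReal.mk (√l ^ 2) (sq_nonneg _) * 1 = l.toNNReal := by
    ext; simp [Real.sq_sqrt hl, Real.coe_toNNReal _ hl]
  rw [h2, mul_zero] at h
  rw [← h, integral_map (by fun_prop) (by fun_prop), ← integral_const_mul]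
  refine integral_congr_ae (Eventually.of_forall fun x => ?_)
  simp only [mul_pow]
  rw [show √l ^ 4 = (√l ^ 2) ^ 2 by ring, Real.sq_sqrt hl]

lemma integrable_pow_four_gaussianReal (v : ℝ≥0) :
    Integrable (fun x : ℝ => x ^ 4) (gaussianReal 0 v) := by
  have h := (memLp_id_gaussianReal (μ := 0) (v := v) 4).integrable_norm_pow (by norm_num)
  refine h.congr (Eventually.of_forall fun x => ?_)
  simp [show |x| ^ 4 = (|x| ^ 2) ^ 2 by ring]
  ring

lemma sum_sq_sq_le {m : ℕ} (x : Fin m → ℝ) : (∑ j, x j ^ 2) ^ 2 ≤ m * ∑ j, x j ^ 4 := by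
  have h := sq_sum_le_card_mul_sum_sq (s := Finset.univ) (f := fun j => x j ^ 2)
  simpa [← pow_mul] using h

/-- Upper bound on the mean squared distance achieved by the best codebook with `n + 1` points. -/
lemma exists_codebook_integral_le [IsProbabilityMeasure P]
    (hXmeas : AEStronglyMeasurable X P) (hXint : Integrable (fun ω => ‖X ω‖ ^ 2) P)
    (hGauss : ∀ y : H, ∃ v : ℝ≥0, Measure.map (fun ω => ⟪y, X ω⟫) P = gaussianReal 0 v)
    (hu : Orthonormal ℝ u) (hlam : ∀ j, 0 < lam j) (hanti : Antitone lam)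
    (heig : ∀ j, ∀ y : H, ∫ ω, ⟪u j, X ω⟫ * ⟪y, X ω⟫ ∂P = lam j * ⟪u j, y⟫)
    {ε : ℝ} (h0 : 0 < ε) (h1 : ε < 1) :
    ∃ σ K : ℝ, 0 < σ ∧ σ < 1 ∧ 0 ≤ K ∧ ∀ m n : ℕ,
      exp (∑ j : Fin m, 1 / 2 * log (lam j / lam m) + 2 * ε * m) ≤ n →
      ∃ α : Finset H, α.Nonempty ∧ α.card ≤ n + 1 ∧
        ∫ ω, sqDist α (X ω) ∂P ≤ (∫ ω, ‖X ω‖ ^ 2 ∂P - ∑ j : Fin m, lam j) +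
          m * lam m * (1 + ε) + (K * m ^ 2 + 1) * σ ^ m := by
  classical
  obtain ⟨ρ, hρ0, hρ1, hcode⟩ := exists_gaussian_codebook h0 h1
  set M : ℝ := ∫ x, x ^ 4 ∂gaussianReal 0 1
  have hM : 0 ≤ M := integral_nonneg fun x => by positivity
  refine ⟨√ρ, lam 0 ^ 2 * M, sqrt_pos.2 hρ0, ?_, by positivity, fun m n hn => ?_⟩
  · rw [sqrt_lt' one_pos]; simpa using hρ1
  obtain ⟨c, hc⟩ := hcode m (fun j => lam j) (lam m) (hlam m) (fun j => hanti j.2.le) n hn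
  set S : Set (Fin m → ℝ) := {x | ∀ i, m * lam m * (1 + ε) < ∑ j, (x j - c i j) ^ 2} with hS
  have hSm : MeasurableSet S := by
    have : S = ⋂ i, {x | m * lam m * (1 + ε) < ∑ j, (x j - c i j) ^ 2} := by
      ext x; simp [hS]
    rw [this]
    exact MeasurableSet.iInter fun i => measurableSet_lt measurable_const (by fun_prop)
  set Y : Ω → Fin m → ℝ := fun ω j => ⟪u j, X ω⟫ with hY
  have hYm : AEMeasurable Y P :=
    aemeasurable_pi_lambda _ fun j => aemeasurable_inner_of_gaussian hGauss _
  set α : Finset H := insert 0 (Finset.univ.image fun i => ∑ j : Fin m, c i j • u j) with hα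
  have hαn : α.Nonempty := Finset.insert_nonempty _ _
  refine ⟨α, hαn, ?_, ?_⟩
  · refine (Finset.card_insert_le _ _).trans ?_
    gcongr
    exact Finset.card_image_le.trans (by simp)
  have hδ : 0 < √ρ ^ m := pow_pos (sqrt_pos.2 hρ0) m
  set I : Ω → ℝ := fun ω => S.indicator (fun _ => (1 : ℝ)) (Y ω) with hI
  have hIint : Integrable I P := by
    have h2 : Integrable (S.indicator fun _ => (1 : ℝ)) (P.map Y) :=
      (integrable_const (1 : ℝ)).indicator hSm
    exact h2.comp_aemeasurable hYm
  have hIle : ∫ ω, I ω ∂P ≤ 4 * ρ ^ m := by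
    have h2 : ∫ ω, I ω ∂P = ∫ x, S.indicator (fun _ => (1 : ℝ)) x ∂(P.map Y) :=
      (integral_map hYm (stronglyMeasurable_const.indicator hSm).aestronglyMeasurable).symm
    rw [h2, map_coords_eq_pi hGauss hu heig, integral_indicator_const _ hSm, smul_eq_mul, mul_one]
    exact ENNReal.toReal_le_of_le_ofReal (by positivity) hc
  have hpt : ∀ ω, sqDist α (X ω) ≤ ‖X ω‖ ^ 2 - ∑ j : Fin m, ⟪u j, X ω⟫ ^ 2 +
      m * lam m * (1 + ε) + √ρ ^ m * (m * ∑ j : Fin m, ⟪u j, X ω⟫ ^ 4) +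
        I ω / (4 * √ρ ^ m) := by
    intro ω
    have hD : 0 ≤ m * lam m * (1 + ε) := by have := hlam m; positivity
    have hs4 := sum_sq_sq_le (Y ω)
    by_cases hω : Y ω ∈ S
    · have h2 : I ω = 1 := by simp [hI, hω]
      have h3 := sqDist_le (Finset.mem_insert_self (0 : H) _ : (0 : H) ∈ α) (X ω)
      rw [sub_zero] at h3
      rw [h2]
      simp only [hY] at hs4
      set w := ∑ j : Fin m, ⟪u j, X ω⟫ ^ 2
      have h4 := mul_le_mul_of_nonneg_left hs4 hδ.le
      have h5 : w ≤ √ρ ^ m * w ^ 2 + 1 / (4 * √ρ ^ m) := by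
        have : √ρ ^ m * w ^ 2 + 1 / (4 * √ρ ^ m) - w =
            (2 * √ρ ^ m * w - 1) ^ 2 / (4 * √ρ ^ m) := by field_simp; ring
        have h6 : 0 ≤ (2 * √ρ ^ m * w - 1) ^ 2 / (4 * √ρ ^ m) := by positivity
        linarith
      linarith
    · have h2 : I ω = 0 := by simp [hI, hω]
      simp only [hS, Set.mem_ofPred_eq, not_forall, not_lt] at hω
      obtain ⟨i, hi⟩ := hω
      have h3 := sqDist_le (Finset.mem_insert_of_mem
        (Finset.mem_image_of_mem (fun i => ∑ j : Fin m, c i j • u j) (Finset.mem_univ i)) :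
        ∑ j : Fin m, c i j • u j ∈ α) (X ω)
      rw [norm_sub_sum_smul_sq hu] at h3
      have h4 : 0 ≤ √ρ ^ m * (m * ∑ j : Fin m, ⟪u j, X ω⟫ ^ 4) := by positivity
      rw [h2, zero_div]
      simp only [hY] at hi
      linarith
  have hi1 : Integrable (fun ω => ∑ j : Fin m, ⟪u j, X ω⟫ ^ 2) P :=
    integrable_finsetSum _ fun j _ => (memLp_inner_of_gaussian hGauss _).integrable_sq
  have h4 : ∀ j, Integrable (fun ω => ⟪u j, X ω⟫ ^ 4) P ∧
      ∫ ω, ⟪u j, X ω⟫ ^ 4 ∂P ≤ lam 0 ^ 2 * M := by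
    intro j
    have hm := aemeasurable_inner_of_gaussian hGauss (u j)
    have hl := map_inner_eigenvector hGauss hu heig j
    refine ⟨?_, ?_⟩
    · have h2 := integrable_pow_four_gaussianReal (lam j).toNNReal
      rw [← hl] at h2
      exact h2.comp_aemeasurable hm
    · have h2 := integral_map hm (f := fun x : ℝ => x ^ 4) (by fun_prop)
      rw [← h2, hl, integral_pow_four_gaussianReal (hlam j).le]
      have := hanti (Nat.zero_le j)
      have := hlam j
      gcongr
  have hi4 : Integrable (fun ω => √ρ ^ m * (m * ∑ j : Fin m, ⟪u j, X ω⟫ ^ 4)) P :=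
    ((integrable_finsetSum _ fun (j : Fin m) _ => (h4 j).1).const_mul _).const_mul _
  have hiA : Integrable (fun ω => ‖X ω‖ ^ 2 - ∑ j : Fin m, ⟪u j, X ω⟫ ^ 2) P := hXint.sub hi1
  have hiB : Integrable (fun ω => ‖X ω‖ ^ 2 - ∑ j : Fin m, ⟪u j, X ω⟫ ^ 2 +
      m * lam m * (1 + ε)) P := hiA.add (integrable_const _)
  have hiC : Integrable (fun ω => ‖X ω‖ ^ 2 - ∑ j : Fin m, ⟪u j, X ω⟫ ^ 2 +
      m * lam m * (1 + ε) + √ρ ^ m * (m * ∑ j : Fin m, ⟪u j, X ω⟫ ^ 4)) P := hiB.add hi4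
  have hle := integral_mono (integrable_sqDist hXmeas hXint hαn)
    (hiC.add (hIint.div_const (4 * √ρ ^ m))) hpt
  refine hle.trans ?_
  simp only [Pi.add_apply]
  rw [integral_add hiC (hIint.div_const _), integral_add hiB hi4,
    integral_add hiA (integrable_const _), integral_sub hXint hi1, integral_const, probReal_univ,
    one_smul, integral_const_mul, integral_const_mul, integral_div,
    integral_finsetSum _ fun (j : Fin m) _ => (memLp_inner_of_gaussian hGauss _).integrable_sq,
    integral_finsetSum _ fun (j : Fin m) _ => (h4 j).1]
  simp_rw [integral_coord_sq hu heig]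
  have h5 : ∑ j : Fin m, ∫ ω, ⟪u j, X ω⟫ ^ 4 ∂P ≤ m * (lam 0 ^ 2 * M) := by
    refine (Finset.sum_le_sum fun (j : Fin m) _ => (h4 j).2).trans_eq ?_
    simp
  have h6 : (∫ ω, I ω ∂P) / (4 * √ρ ^ m) ≤ √ρ ^ m := by
    rw [div_le_iff₀ (by positivity)]
    refine hIle.trans_eq ?_
    have : ρ ^ m = √ρ ^ m * √ρ ^ m := by rw [← mul_pow, mul_self_sqrt hρ0.le]
    rw [this]; ring
  have h7 : √ρ ^ m * (m * ∑ j : Fin m, ∫ ω, ⟪u j, X ω⟫ ^ 4 ∂P) ≤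
      √ρ ^ m * (m * (m * (lam 0 ^ 2 * M))) := by gcongr
  have h8 : √ρ ^ m * (m * (m * (lam 0 ^ 2 * M))) = lam 0 ^ 2 * M * m ^ 2 * √ρ ^ m := by ring
  rw [add_mul, one_mul]
  linarith

end UpperBound

section Trace

variable {H : Type*} [NormedAddCommGroup H] [InnerProductSpace ℝ H]
  {Ω : Type*} [MeasurableSpace Ω] {P : Measure Ω} {X : Ω → H}
  {u : ℕ → H} {lam : ℕ → ℝ}

lemma hasSum_inner_sq_of_mem_closure_span (hu : Orthonormal ℝ u) {x : H}
    (hx : x ∈ closure (Submodule.span ℝ (Set.range u) : Set H)) :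
    HasSum (fun j => ⟪u j, x⟫ ^ 2) (‖x‖ ^ 2) := by
  have hle : ∀ N, ∑ j ∈ Finset.range N, ⟪u j, x⟫ ^ 2 ≤ ‖x‖ ^ 2 := by
    intro N
    have h := hu.sum_inner_products_le x (s := Finset.range N)
    simpa using h
  rw [hasSum_iff_tendsto_nat_of_nonneg fun j => sq_nonneg _]
  refine tendsto_atTop_isLUB (fun a b hab => Finset.sum_le_sum_of_subset_of_nonneg
    (Finset.range_mono hab) fun _ _ _ => sq_nonneg _) ⟨?_, fun y hy => ?_⟩
  · rintro _ ⟨N, rfl⟩; exact hle N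
  refine le_of_forall_pos_le_add fun ε hε => ?_
  obtain ⟨a, ha, hxa⟩ := Metric.mem_closure_iff.1 hx (√ε) (sqrt_pos.2 hε)
  obtain ⟨c, rfl⟩ := Finsupp.mem_span_range_iff_exists_finsupp.1 ha
  set N := c.support.sup id + 1
  have hsum : (c.sum fun i r => r • u i) = ∑ j : Fin N, c j • u j := by
    rw [Fin.sum_univ_eq_sum_range (fun j => c j • u j) N]
    refine Finsupp.sum_of_support_subset _ (fun i hi => ?_) _ (by simp)
    exact Finset.mem_range.2 (Nat.lt_succ_of_le (Finset.le_sup (f := id) hi))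
  rw [hsum, dist_eq_norm] at hxa
  have h1 := norm_sub_sum_smul_sq hu (fun j : Fin N => c j) x
  have h2 : ‖x - ∑ j : Fin N, c j • u j‖ ^ 2 ≤ ε := by
    rw [← sq_sqrt hε.le]; gcongr
  have h3 : ∑ j : Fin N, ⟪u j, x⟫ ^ 2 ≤ y := by
    rw [Fin.sum_univ_eq_sum_range (fun j => ⟪u j, x⟫ ^ 2) N]; exact hy ⟨N, rfl⟩
  have h4 : 0 ≤ ∑ j : Fin N, (⟪u j, x⟫ - c j) ^ 2 := Finset.sum_nonneg fun _ _ => sq_nonneg _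
  linarith

/-- The trace of the covariance operator is the second moment. -/
lemma hasSum_eigenvalues [IsProbabilityMeasure P]
    (hXint : Integrable (fun ω => ‖X ω‖ ^ 2) P)
    (hGauss : ∀ y : H, ∃ v : ℝ≥0, Measure.map (fun ω => ⟪y, X ω⟫) P = gaussianReal 0 v)
    (hu : Orthonormal ℝ u) (hlam : ∀ j, 0 < lam j)
    (heig : ∀ j, ∀ y : H, ∫ ω, ⟪u j, X ω⟫ * ⟪y, X ω⟫ ∂P = lam j * ⟪u j, y⟫)
    (hspan : ∀ᵐ ω ∂P, X ω ∈ closure (Submodule.span ℝ (Set.range u) : Set H)) :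
    HasSum lam (∫ ω, ‖X ω‖ ^ 2 ∂P) := by
  rw [hasSum_iff_tendsto_nat_of_nonneg fun j => (hlam j).le]
  have hsq_int : ∀ j, Integrable (fun ω => ⟪u j, X ω⟫ ^ 2) P := fun j =>
    (memLp_inner_of_gaussian hGauss _).integrable_sq
  have hsum : ∀ N, ∑ j ∈ Finset.range N, lam j =
      ∫ ω, ∑ j ∈ Finset.range N, ⟪u j, X ω⟫ ^ 2 ∂P := by
    intro N
    rw [integral_finsetSum _ fun j _ => hsq_int j]
    exact Finset.sum_congr rfl fun j _ => (integral_coord_sq hu heig j).symm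
  simp_rw [hsum]
  refine tendsto_integral_of_dominated_convergence (fun ω => ‖X ω‖ ^ 2)
    (fun N => (integrable_finsetSum _ fun j _ => hsq_int j).aestronglyMeasurable) hXint
    (fun N => Eventually.of_forall fun ω => ?_) ?_
  · rw [norm_of_nonneg (Finset.sum_nonneg fun _ _ => sq_nonneg _)]
    have h := hu.sum_inner_products_le (X ω) (s := Finset.range N)
    simpa using h
  · filter_upwards [hspan] with ω hω
    exact (hasSum_inner_sq_of_mem_closure_span hu hω).tendsto_sum_nat

end Trace

section RegularVariation

variable {ι : Type*} {l : Filter ι} {s b : ℝ} {φ : ℝ → ℝ} {lam : ℕ → ℝ}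

lemma tendsto_regularlyVarying_ratio (hφ_pos : ∀ x, s < x → 0 < φ x)
    (hφ_dec : ∀ x y, s < x → x ≤ y → φ y ≤ φ x)
    (hφ_rv : ∀ c : ℝ, 0 < c →
      Tendsto (fun x : ℝ => φ (c * x) / φ x) atTop (nhds (c ^ (-b))))
    {k x : ι → ℝ} {c : ℝ} (hc : 0 < c) (hx : Tendsto x l atTop)
    (hk : Tendsto (fun i => k i / x i) l (nhds c)) :
    Tendsto (fun i => φ (k i) / φ (x i)) l (nhds (c ^ (-b))) := by
  have hcont : ContinuousAt (fun r : ℝ => r ^ (-b)) c :=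
    continuousAt_rpow_const c (-b) (Or.inl hc.ne')
  have hx0 : ∀ᶠ i in l, 0 < x i := hx.eventually_gt_atTop 0
  have hxs : ∀ᶠ i in l, s < x i := hx.eventually_gt_atTop s
  refine tendsto_order.2 ⟨fun a ha => ?_, fun a ha => ?_⟩
  · obtain ⟨d, hda, hd⟩ := (((hcont.tendsto.eventually_const_lt ha).filter_mono
      nhdsWithin_le_nhds).and (self_mem_nhdsWithin (s := Set.Ioi c))).exists
    have hd : c < d := hd
    have hkd := hk.eventually_lt_const hd
    have hks : ∀ᶠ i in l, s < k i := by
      have h2 := (hx.const_mul_atTop (half_pos hc)).eventually_gt_atTop s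
      filter_upwards [h2, hk.eventually_const_lt (half_lt_self hc), hx0] with i h2 h3 h4
      rw [lt_div_iff₀ h4] at h3
      linarith
    filter_upwards [hkd, hks, hx0, hxs,
      hx.eventually ((hφ_rv d (hc.trans hd)).eventually_const_lt hda)] with i h1 h2 h3 h4 h5
    refine h5.trans_le ?_
    have := hφ_pos _ h4
    gcongr
    exact hφ_dec _ _ h2 ((div_lt_iff₀ h3).1 h1).le
  · obtain ⟨d, ⟨hda, hd0⟩, hd⟩ := ((((hcont.tendsto.eventually_lt_const ha).and
      (lt_mem_nhds hc)).filter_mono nhdsWithin_le_nhds).and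
      (self_mem_nhdsWithin (s := Set.Iio c))).exists
    have hd : d < c := hd
    have hkd := hk.eventually_const_lt hd
    have hds := (hx.const_mul_atTop hd0).eventually_gt_atTop s
    filter_upwards [hkd, hds, hx0, hxs,
      hx.eventually ((hφ_rv d hd0).eventually_lt_const hda)] with i h1 h2 h3 h4 h5
    refine lt_of_le_of_lt ?_ h5
    have := hφ_pos _ h4
    gcongr
    exact hφ_dec _ _ h2 ((lt_div_iff₀ h3).1 h1).le

lemma tendsto_atTop_of_ratio {k x : ι → ℝ} {c : ℝ} (hc : 0 < c) (hx : Tendsto x l atTop)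
    (hk : Tendsto (fun i => k i / x i) l (nhds c)) : Tendsto k l atTop := by
  refine (hk.pos_mul_atTop hc hx).congr' ?_
  filter_upwards [hx.eventually_gt_atTop 0] with i hi
  field_simp

/-- A sequence is regularly varying of index `-b` if `lam k / lam m → c ^ (-b)` whenever
`k / m → c`. -/
def SeqRegVar (lam : ℕ → ℝ) (b : ℝ) : Prop :=
  ∀ (c : ℝ), 0 < c → ∀ k m : ℕ → ℕ, Tendsto m atTop atTop →
    Tendsto (fun i => (k i : ℝ) / m i) atTop (nhds c) →
    Tendsto (fun i => lam (k i) / lam (m i)) atTop (nhds (c ^ (-b)))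

lemma tendsto_eigenvalue_div (hφ_pos : ∀ x, s < x → 0 < φ x)
    (hφ_dec : ∀ x y, s < x → x ≤ y → φ y ≤ φ x)
    (hφ_rv : ∀ c : ℝ, 0 < c →
      Tendsto (fun x : ℝ => φ (c * x) / φ x) atTop (nhds (c ^ (-b))))
    (hasymp : Tendsto (fun j : ℕ => lam j / φ j) atTop (nhds 1))
    {k : ι → ℕ} {x : ι → ℝ} {c : ℝ} (hc : 0 < c) (hx : Tendsto x l atTop)
    (hk : Tendsto (fun i => (k i : ℝ) / x i) l (nhds c)) :
    Tendsto (fun i => lam (k i) / φ (x i)) l (nhds (c ^ (-b))) := by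
  have hkt := tendsto_atTop_of_ratio hc hx hk
  have h1 := (hasymp.comp (tendsto_natCast_atTop_iff.1 hkt)).mul
    (tendsto_regularlyVarying_ratio hφ_pos hφ_dec hφ_rv hc hx hk)
  rw [one_mul] at h1
  refine h1.congr' ?_
  filter_upwards [hkt.eventually_gt_atTop s] with i hi
  have := (hφ_pos _ hi).ne'
  simp only [Function.comp]
  field_simp

lemma seqRegVar_of_asymptotics (hφ_pos : ∀ x, s < x → 0 < φ x)
    (hφ_dec : ∀ x y, s < x → x ≤ y → φ y ≤ φ x)
    (hφ_rv : ∀ c : ℝ, 0 < c →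
      Tendsto (fun x : ℝ => φ (c * x) / φ x) atTop (nhds (c ^ (-b))))
    (hasymp : Tendsto (fun j : ℕ => lam j / φ j) atTop (nhds 1)) : SeqRegVar lam b := by
  intro c hc k m hm hk
  have hm' : Tendsto (fun i => (m i : ℝ)) atTop atTop := tendsto_natCast_atTop_iff.2 hm
  have h1 := tendsto_eigenvalue_div hφ_pos hφ_dec hφ_rv hasymp hc hm' hk
  have h2 := h1.div (hasymp.comp hm) one_ne_zero
  rw [div_one] at h2
  refine h2.congr' ?_
  filter_upwards [hm'.eventually_gt_atTop s] with i hi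
  have := (hφ_pos _ hi).ne'
  simp only [Function.comp, Pi.div_apply]
  field_simp

/-- A polynomial upper bound for ratios of a positive antitone regularly varying sequence. -/
lemma exists_pow_ratio_bound (hpos : ∀ j, 0 < lam j) (hanti : Antitone lam)
    (hrv : SeqRegVar lam b) :
    ∃ B : ℕ, ∀ j m, j ≤ m → lam j ≤ (2 * (m + 1) / (j + 1) : ℝ) ^ B * lam m := by
  have h1 : Tendsto (fun j : ℕ => lam j / lam (2 * j + 1)) atTop
      (nhds ((1 / 2 : ℝ) ^ (-b))) := by
    refine hrv (1 / 2) (by norm_num) (fun j => j) (fun j => 2 * j + 1)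
      (tendsto_atTop_mono (fun j => by simp only [id]; lia) tendsto_id) ?_
    have h2 : Tendsto (fun j : ℕ => (1 / 2 : ℝ) - 1 / 2 * (1 / (2 * (j : ℝ) + 1))) atTop
        (nhds (1 / 2 - 1 / 2 * 0)) := by
      refine tendsto_const_nhds.sub (Tendsto.const_mul _ ?_)
      simp_rw [one_div]
      refine tendsto_inv_atTop_zero.comp (tendsto_atTop_add_const_right _ _ ?_)
      exact tendsto_natCast_atTop_atTop.const_mul_atTop (by norm_num)
    rw [mul_zero, sub_zero] at h2
    refine h2.congr fun j => ?_
    push_cast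
    field_simp
    ring
  obtain ⟨M, hM⟩ := h1.bddAbove_range
  obtain ⟨B, hB⟩ := pow_unbounded_of_one_lt M (one_lt_two : (1 : ℝ) < 2)
  have hdouble : ∀ j, lam j ≤ 2 ^ B * lam (2 * j + 1) := fun j => by
    rw [← div_le_iff₀ (hpos _)]
    exact (hM ⟨j, rfl⟩).trans hB.le
  refine ⟨B, ?_⟩
  suffices h : ∀ d j m : ℕ, j ≤ m → m - j ≤ d →
      lam j ≤ (2 * (m + 1) / (j + 1) : ℝ) ^ B * lam m from
    fun j m hjm => h (m - j) j m hjm le_rfl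
  intro d
  induction d with
  | zero =>
    intro j m hjm hd
    obtain rfl : j = m := by lia
    have : (1 : ℝ) ≤ (2 * (j + 1) / (j + 1) : ℝ) ^ B :=
      one_le_pow₀ (by rw [mul_div_assoc, div_self (by positivity)]; norm_num)
    exact le_mul_of_one_le_left (hpos j).le this
  | succ d ih =>
    intro j m hjm hd
    rcases le_or_gt m (2 * j + 1) with h | h
    · refine (hdouble j).trans ?_
      have h2 := hanti h
      have : (2 : ℝ) ≤ 2 * (m + 1) / (j + 1) := by
        rw [le_div_iff₀ (by positivity)]
        have : (j : ℝ) ≤ m := by exact_mod_cast hjm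
        linarith
      have h3 := (hpos m).le
      have h4 := (hpos (2 * j + 1)).le
      gcongr
    · refine (hdouble j).trans ?_
      have h2 := ih (2 * j + 1) m h.le (by lia)
      refine (mul_le_mul_of_nonneg_left h2 (by positivity)).trans_eq ?_
      rw [← mul_assoc, ← mul_pow]
      congr 2
      push_cast
      field_simp
      ring

/-- A Potter-type bound. -/
lemma exists_potter_bound (hpos : ∀ j, 0 < lam j) (hanti : Antitone lam)
    (hrv : SeqRegVar lam b) {a : ℝ} (ha0 : 0 < a) (ha : a < b) :
    ∃ m₀ : ℕ, 0 < m₀ ∧ ∀ m k, m₀ ≤ m → m ≤ k → lam k ≤ (2 * m / k : ℝ) ^ a * lam m := by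
  have h1 : Tendsto (fun j : ℕ => lam (2 * j) / lam j) atTop (nhds ((2 : ℝ) ^ (-b))) := by
    refine hrv 2 (by norm_num) (fun j => 2 * j) (fun j => j) tendsto_id ?_
    refine tendsto_const_nhds.congr' ?_
    filter_upwards [eventually_gt_atTop 0] with j hj
    have : (0 : ℝ) < j := by exact_mod_cast hj
    push_cast
    field_simp
  have hlt : (2 : ℝ) ^ (-b) < 2 ^ (-a) := rpow_lt_rpow_of_exponent_lt one_lt_two (by linarith)
  obtain ⟨m₁, hm₁⟩ := eventually_atTop.1 (h1.eventually_lt_const hlt)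
  refine ⟨m₁ + 1, by lia, ?_⟩
  suffices h : ∀ d m k : ℕ, m₁ + 1 ≤ m → m ≤ k → k - m ≤ d →
      lam k ≤ (2 * m / k : ℝ) ^ a * lam m from
    fun m k h0 hmk => h (k - m) m k h0 hmk le_rfl
  have hsmall : ∀ m k : ℕ, m₁ + 1 ≤ m → m ≤ k → k ≤ 2 * m →
      lam k ≤ (2 * m / k : ℝ) ^ a * lam m := by
    intro m k h0 hmk hk
    refine (hanti hmk).trans (le_mul_of_one_le_left (hpos m).le (one_le_rpow ?_ ha0.le))
    have : (0 : ℝ) < k := by exact_mod_cast (by lia : 0 < k)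
    rw [one_le_div this]
    exact_mod_cast hk
  intro d
  induction d with
  | zero =>
    intro m k h0 hmk hd
    exact hsmall m k h0 hmk (by lia)
  | succ d ih =>
    intro m k h0 hmk hd
    rcases le_or_gt k (2 * m) with h | h
    · exact hsmall m k h0 hmk h
    · refine (ih (2 * m) k (by lia) h.le (by lia)).trans ?_
      have h2 := hm₁ m (by lia)
      rw [div_lt_iff₀ (hpos m)] at h2
      have hk : (0 : ℝ) ≤ 2 * m / k := by positivity
      push_cast
      rw [mul_div_assoc, mul_rpow zero_le_two hk]
      calc (2 : ℝ) ^ a * (2 * m / k) ^ a * lam (2 * m)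
          ≤ 2 ^ a * (2 * m / k) ^ a * (2 ^ (-a) * lam m) := by gcongr
        _ = (2 ^ a * 2 ^ (-a)) * ((2 * m / k) ^ a * lam m) := by ring
        _ = _ := by rw [← rpow_add two_pos, add_neg_cancel, rpow_zero, one_mul]

end RegularVariation

section Karamata

variable {b : ℝ} {lam : ℕ → ℝ}

lemma eqOn_floor_const (f : ℕ → ℝ) (j : ℕ) :
    Set.EqOn (fun u : ℝ => f ⌊u⌋₊) (fun _ => f j) (Set.Ioo (j : ℝ) ((j + 1 : ℕ) : ℝ)) := by
  intro u hu
  have : ⌊u⌋₊ = j := (Nat.floor_eq_iff (j.cast_nonneg.trans hu.1.le)).2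
    ⟨hu.1.le, by simpa using hu.2⟩
  simp [this]

lemma intervalIntegrable_comp_floor (f : ℕ → ℝ) (j : ℕ) :
    IntervalIntegrable (fun u : ℝ => f ⌊u⌋₊) volume (j : ℝ) ((j + 1 : ℕ) : ℝ) := by
  have hle : (j : ℝ) ≤ ((j + 1 : ℕ) : ℝ) := by simp
  rw [intervalIntegrable_iff_integrableOn_Ioo_of_le hle]
  refine IntegrableOn.congr_fun ?_ (eqOn_floor_const f j).symm measurableSet_Ioo
  exact integrableOn_const (by simp)

lemma integral_comp_floor (f : ℕ → ℝ) {k m : ℕ} (hkm : k ≤ m) :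
    ∫ u in (k : ℝ)..m, f ⌊u⌋₊ = ∑ j ∈ Finset.Ico k m, f j := by
  rw [← intervalIntegral.sum_integral_adjacent_intervals_Ico (a := fun j : ℕ => (j : ℝ)) hkm
    fun j _ => intervalIntegrable_comp_floor f j]
  refine Finset.sum_congr rfl fun j _ => ?_
  have hle : (j : ℝ) ≤ ((j + 1 : ℕ) : ℝ) := by simp
  rw [intervalIntegral.integral_of_le hle, integral_Ioc_eq_integral_Ioo,
    setIntegral_congr_fun measurableSet_Ioo (eqOn_floor_const f j)]
  simp

lemma integral_unit_comp_floor (f : ℕ → ℝ) {m : ℕ} (hm : 0 < m) :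
    ∫ u in (0 : ℝ)..1, f ⌊u * m⌋₊ = (∑ j ∈ Finset.range m, f j) / m := by
  have hm' : (m : ℝ) ≠ 0 := by exact_mod_cast hm.ne'
  rw [intervalIntegral.integral_comp_mul_right (fun x : ℝ => f ⌊x⌋₊) hm', zero_mul, one_mul,
    show (0 : ℝ) = ((0 : ℕ) : ℝ) by simp, integral_comp_floor f (Nat.zero_le m),
    ← Finset.range_eq_Ico, smul_eq_mul]
  field_simp

lemma measurable_comp_floor_mul (f : ℕ → ℝ) (m : ℕ) :
    Measurable fun u : ℝ => f ⌊u * m⌋₊ :=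
  (measurable_of_countable f).comp (Nat.measurable_floor.comp (measurable_id.mul_const _))

lemma integrableOn_Ioi_comp_floor {f : ℕ → ℝ} (hf : ∀ j, 0 ≤ f j) (hs : Summable f) (m : ℕ) :
    IntegrableOn (fun u : ℝ => f ⌊u⌋₊) (Set.Ioi (m : ℝ)) := by
  refine integrableOn_Ioi_of_intervalIntegral_norm_bounded (l := atTop)
    (b := fun N : ℕ => (N : ℝ)) (∑' j, f j) (m : ℝ) (fun N => ?_) tendsto_natCast_atTop_atTop ?_
  · rcases le_or_gt N m with h | h
    · rw [Set.Ioc_eq_empty (by simpa using h)]; exact integrableOn_empty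
    · have hle : (m : ℝ) ≤ N := by exact_mod_cast h.le
      rw [← intervalIntegrable_iff_integrableOn_Ioc_of_le hle]
      exact IntervalIntegrable.trans_iterate_Ico (a := fun j : ℕ => (j : ℝ)) h.le
        fun j _ => intervalIntegrable_comp_floor f j
  · filter_upwards [eventually_ge_atTop m] with N hN
    simp_rw [norm_of_nonneg (hf _)]
    rw [integral_comp_floor f hN]
    exact hs.sum_le_tsum _ fun j _ => hf j

lemma integral_Ioi_comp_floor {f : ℕ → ℝ} {S : ℝ} (hf : ∀ j, 0 ≤ f j) (hs : HasSum f S) (m : ℕ) :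
    ∫ u in Set.Ioi (m : ℝ), f ⌊u⌋₊ = S - ∑ j ∈ Finset.range m, f j := by
  have h1 := intervalIntegral_tendsto_integral_Ioi (m : ℝ)
    (integrableOn_Ioi_comp_floor hf hs.summable m) (tendsto_natCast_atTop_atTop (R := ℝ))
  have h2 := hs.tendsto_sum_nat.sub_const (∑ j ∈ Finset.range m, f j)
  refine tendsto_nhds_unique h1 (h2.congr' ?_)
  filter_upwards [eventually_ge_atTop m] with N hN
  rw [integral_comp_floor f hN, Finset.sum_Ico_eq_sub _ hN]

lemma integral_Ioi_one_comp_floor {f : ℕ → ℝ} {S : ℝ} (hf : ∀ j, 0 ≤ f j) (hs : HasSum f S)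
    {m : ℕ} (hm : 0 < m) :
    ∫ u in Set.Ioi (1 : ℝ), f ⌊u * m⌋₊ = (S - ∑ j ∈ Finset.range m, f j) / m := by
  have hm' : (0 : ℝ) < m := by exact_mod_cast hm
  rw [integral_comp_mul_right_Ioi (fun x : ℝ => f ⌊x⌋₊) 1 hm', one_mul,
    integral_Ioi_comp_floor hf hs, smul_eq_mul]
  field_simp

lemma tendsto_floor_mul_ratio (hrv : SeqRegVar lam b) {u : ℝ} (hu : 0 < u) :
    Tendsto (fun m : ℕ => lam ⌊u * m⌋₊ / lam m) atTop (nhds (u ^ (-b))) :=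
  hrv u hu _ _ tendsto_id
    ((tendsto_nat_floor_mul_div_atTop hu.le).comp tendsto_natCast_atTop_atTop)

/-- The mean logarithmic ratio of a regularly varying sequence converges to the index. -/
lemma tendsto_mean_log_ratio (hpos : ∀ j, 0 < lam j) (hanti : Antitone lam)
    (hrv : SeqRegVar lam b) :
    Tendsto (fun m : ℕ => (∑ j ∈ Finset.range m, log (lam j / lam m)) / m) atTop (nhds b) := by
  obtain ⟨B, hB⟩ := exists_pow_ratio_bound hpos hanti hrv
  have hlim : b = ∫ u in (0 : ℝ)..1, -b * log u := by
    rw [intervalIntegral.integral_const_mul, integral_log]; simp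
  rw [hlim]
  suffices h : Tendsto (fun m : ℕ => ∫ u in (0 : ℝ)..1, log (lam ⌊u * m⌋₊ / lam m)) atTop
      (nhds (∫ u in (0 : ℝ)..1, -b * log u)) by
    refine h.congr' ?_
    filter_upwards [eventually_gt_atTop 0] with m hm
    exact integral_unit_comp_floor (fun j => log (lam j / lam m)) hm
  refine intervalIntegral.tendsto_integral_filter_of_dominated_convergence
    (fun u => B * (log 4 - log u)) ?_ ?_ ?_ ?_
  · exact Eventually.of_forall fun m =>
      (measurable_comp_floor_mul (fun j => log (lam j / lam m)) m).aestronglyMeasurable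
  · filter_upwards [eventually_gt_atTop 0] with m hm
    refine Eventually.of_forall fun u hu => ?_
    rw [Set.uIoc_of_le zero_le_one] at hu
    have hm1 : (1 : ℝ) ≤ m := by exact_mod_cast hm
    have hfl : ⌊u * m⌋₊ ≤ m := by
      refine Nat.floor_le_of_le ?_
      have := hu.2
      nlinarith
    have h1 : 1 ≤ lam ⌊u * m⌋₊ / lam m := (one_le_div (hpos m)).2 (hanti hfl)
    rw [norm_of_nonneg (log_nonneg h1)]
    have h2 : lam ⌊u * m⌋₊ / lam m ≤ (4 / u) ^ B := by
      rw [div_le_iff₀ (hpos m)]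
      refine (hB _ _ hfl).trans ?_
      have h3 := (hpos m).le
      have h4 := Nat.lt_floor_add_one (u * m)
      have h5 : 2 * (m + 1 : ℝ) / (⌊u * m⌋₊ + 1) ≤ 4 / u := by
        rw [div_le_div_iff₀ (by positivity) hu.1]
        have := hu.1
        nlinarith
      gcongr
    refine (log_le_log (by linarith) h2).trans_eq ?_
    rw [log_pow, log_div (by norm_num) hu.1.ne']
  · exact (intervalIntegrable_const.sub intervalIntegral.intervalIntegrable_log').const_mul _
  · refine Eventually.of_forall fun u hu => ?_
    rw [Set.uIoc_of_le zero_le_one] at hu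
    have h1 := (tendsto_floor_mul_ratio hrv hu.1).log (rpow_pos_of_pos hu.1 _).ne'
    rwa [log_rpow hu.1] at h1

/-- Karamata's theorem for tails of regularly varying sums. -/
lemma tendsto_tail_ratio (hpos : ∀ j, 0 < lam j) (hanti : Antitone lam)
    (hrv : SeqRegVar lam b) (hb : 1 < b) {S : ℝ} (hS : HasSum lam S) :
    Tendsto (fun m : ℕ => (S - ∑ j ∈ Finset.range m, lam j) / (m * lam m)) atTop
      (nhds (1 / (b - 1))) := by
  obtain ⟨a, ha1, hab⟩ := exists_between hb
  obtain ⟨m₀, hm₀, hP⟩ := exists_potter_bound hpos hanti hrv (one_pos.trans ha1) hab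
  have hlim : 1 / (b - 1) = ∫ u in Set.Ioi (1 : ℝ), u ^ (-b) := by
    rw [integral_Ioi_rpow_of_lt (by linarith) one_pos, one_rpow,
      show -b + 1 = -(b - 1) by ring, neg_div_neg_eq]
  have hkey : Tendsto (fun m : ℕ => ∫ u in Set.Ioi (1 : ℝ), lam ⌊u * m⌋₊ / lam m) atTop
      (nhds (1 / (b - 1))) := by
    rw [hlim]
    refine tendsto_integral_filter_of_dominated_convergence
      (fun u => (4 : ℝ) ^ a * u ^ (-a)) ?_ ?_ ?_ ?_
    · exact Eventually.of_forall fun m =>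
        ((measurable_comp_floor_mul lam m).div_const _).aestronglyMeasurable
    · filter_upwards [eventually_ge_atTop m₀] with m hm
      refine (ae_restrict_iff' measurableSet_Ioi).2 (Eventually.of_forall fun u hu => ?_)
      have hu : 1 < u := hu
      have hm1 : (1 : ℝ) ≤ m := by exact_mod_cast hm₀.trans_le hm
      have hum : (m : ℝ) ≤ u * m := by nlinarith
      have hfl : m ≤ ⌊u * m⌋₊ := Nat.le_floor hum
      have hfl1 : (1 : ℝ) ≤ ⌊u * m⌋₊ := by exact_mod_cast (hm₀.trans_le hm).trans_le hfl
      rw [norm_of_nonneg (div_nonneg (hpos _).le (hpos _).le), div_le_iff₀ (hpos m)]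
      refine (hP m _ hm hfl).trans ?_
      have h3 := (hpos m).le
      rw [rpow_neg (by linarith), ← div_eq_mul_inv, ← div_rpow (by norm_num) (by linarith)]
      have h4 := Nat.lt_floor_add_one (u * m)
      have h5 : 2 * (m : ℝ) / ⌊u * m⌋₊ ≤ 4 / u := by
        rw [div_le_div_iff₀ (by linarith) (by linarith)]
        nlinarith
      gcongr
    · exact (integrableOn_Ioi_rpow_of_lt (by linarith) one_pos).const_mul _
    · refine (ae_restrict_iff' measurableSet_Ioi).2 (Eventually.of_forall fun u hu => ?_)
      exact tendsto_floor_mul_ratio hrv (one_pos.trans hu)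
  refine hkey.congr' ?_
  filter_upwards [eventually_gt_atTop 0] with m hm
  rw [integral_div, integral_Ioi_one_comp_floor (fun j => (hpos j).le) hS hm, div_div]

lemma tendsto_geometric_div (hpos : ∀ j, 0 < lam j) (hanti : Antitone lam)
    (hrv : SeqRegVar lam b) {σ K : ℝ} (hσ0 : 0 < σ) (hσ1 : σ < 1) (hK : 0 ≤ K) :
    Tendsto (fun m : ℕ => (K * m ^ 2 + 1) * σ ^ m / (m * lam m)) atTop (nhds 0) := by
  obtain ⟨B, hB⟩ := exists_pow_ratio_bound hpos hanti hrv
  have h1 := (tendsto_pow_const_mul_const_pow_of_abs_lt_one (B + 2)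
    (by rwa [abs_of_pos hσ0] : |σ| < 1)).comp (tendsto_add_atTop_nat 1)
  have h2 := h1.const_mul ((K + 1) * 2 ^ B / (lam 0 * σ))
  rw [mul_zero] at h2
  refine squeeze_zero' (Eventually.of_forall fun m => ?_) ?_ h2
  · have := hpos m
    positivity
  filter_upwards [eventually_gt_atTop 0] with m hm
  have hm1 : (1 : ℝ) ≤ m := by exact_mod_cast hm
  have h3 := hB 0 m (Nat.zero_le m)
  simp only [Nat.cast_zero, zero_add, div_one] at h3
  have h0 := hpos 0
  have hpm := hpos m
  have h4 : K * m ^ 2 + 1 ≤ (K + 1) * (m + 1 : ℝ) ^ 2 := by nlinarith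
  have h5 : 1 / (m * lam m) ≤ (2 * (m + 1 : ℝ)) ^ B / lam 0 := by
    rw [div_le_div_iff₀ (by positivity) h0, one_mul]
    refine h3.trans ?_
    gcongr
    nlinarith
  calc (K * m ^ 2 + 1) * σ ^ m / (m * lam m)
      = (K * m ^ 2 + 1) * σ ^ m * (1 / (m * lam m)) := by ring
    _ ≤ (K + 1) * (m + 1 : ℝ) ^ 2 * σ ^ m * ((2 * (m + 1 : ℝ)) ^ B / lam 0) := by gcongr
    _ = _ := by
      simp only [Function.comp, Nat.cast_add, Nat.cast_one, mul_pow]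
      field_simp
      ring

end Karamata

section QuantizationError

variable {H : Type*} [NormedAddCommGroup H] [InnerProductSpace ℝ H]
  {Ω : Type*} [MeasurableSpace Ω] {P : Measure Ω} {X : Ω → H}
  {u : ℕ → H} {lam : ℕ → ℝ}

lemma quantErr_le_sqrt {n : ℕ} {α : Finset H} (hα : α.Nonempty) (hn : α.card ≤ n) {r : ℝ}
    (hr : ∫ ω, sqDist α (X ω) ∂P ≤ r) : quantErr P X n ≤ √r := by
  refine csInf_le_of_le ⟨0, ?_⟩ ⟨α, hα, hn, rfl⟩ ?_
  · rintro _ ⟨β, hβ, -, rfl⟩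
    exact rpow_nonneg (integral_nonneg fun ω => sqDist_nonneg β (X ω)) _
  · rw [← sqrt_eq_rpow]
    exact sqrt_le_sqrt hr

lemma sqrt_le_quantErr {n : ℕ} (hn : 0 < n) {r : ℝ}
    (hr : ∀ α : Finset H, α.Nonempty → α.card ≤ n → r ≤ ∫ ω, sqDist α (X ω) ∂P) :
    √r ≤ quantErr P X n := by
  refine le_csInf ⟨_, {0}, Finset.singleton_nonempty _, by simpa using Nat.succ_le_of_lt hn, rfl⟩ ?_
  rintro _ ⟨β, hβ, hβn, rfl⟩
  rw [← sqrt_eq_rpow]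
  exact sqrt_le_sqrt (hr β hβ hβn)

/-- Reverse water-filling lower bound for the quantization error. -/
lemma sqrt_waterfilling_le_quantErr [IsProbabilityMeasure P]
    (hXmeas : AEStronglyMeasurable X P) (hXint : Integrable (fun ω => ‖X ω‖ ^ 2) P)
    (hGauss : ∀ y : H, ∃ v : ℝ≥0, Measure.map (fun ω => ⟪y, X ω⟫) P = gaussianReal 0 v)
    (hu : Orthonormal ℝ u) (hlam : ∀ j, 0 < lam j) (hanti : Antitone lam)
    (heig : ∀ j, ∀ y : H, ∫ ω, ⟪u j, X ω⟫ * ⟪y, X ω⟫ ∂P = lam j * ⟪u j, y⟫)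
    {S : ℝ} (hS : HasSum lam S) {m n : ℕ} (hn : 0 < n)
    (hR : log n ≤ (∑ j ∈ Finset.range m, log (lam j / lam m)) / 2) :
    √(m * lam m + (S - ∑ j ∈ Finset.range m, lam j)) ≤ quantErr P X n := by
  refine sqrt_le_quantErr hn fun α hα hαn => ?_
  have htend : Tendsto (fun N => m * lam m + (∑ j ∈ Finset.range N, lam j -
      ∑ j ∈ Finset.range m, lam j)) atTop
      (nhds (m * lam m + (S - ∑ j ∈ Finset.range m, lam j))) :=
    (hS.tendsto_sum_nat.sub_const _).const_add _
  refine le_of_tendsto htend ?_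
  filter_upwards [eventually_ge_atTop m] with N hN
  have h := shannon_lower_bound hXmeas hXint hGauss hu hlam heig N (hlam m) hα hαn
  rw [Fin.sum_univ_eq_sum_range (fun j => min (lam j) (lam m)) N,
    Fin.sum_univ_eq_sum_range (fun j => 1 / 2 * log (max (lam j) (lam m) / lam m)) N] at h
  have h1 : ∑ j ∈ Finset.range N, min (lam j) (lam m) =
      m * lam m + (∑ j ∈ Finset.range N, lam j - ∑ j ∈ Finset.range m, lam j) := by
    rw [← Finset.sum_range_add_sum_Ico _ hN, ← Finset.sum_Ico_eq_sub _ hN]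
    congr 1
    · rw [Finset.sum_congr rfl fun j hj =>
        min_eq_right (hanti (Finset.mem_range.1 hj).le)]
      simp
    · exact Finset.sum_congr rfl fun j hj => min_eq_left (hanti (Finset.mem_Ico.1 hj).1)
  have h2 : ∑ j ∈ Finset.range N, 1 / 2 * log (max (lam j) (lam m) / lam m) =
      (∑ j ∈ Finset.range m, log (lam j / lam m)) / 2 := by
    rw [← Finset.sum_range_add_sum_Ico _ hN, Finset.sum_div]
    have h3 : ∑ j ∈ Finset.Ico m N, 1 / 2 * log (max (lam j) (lam m) / lam m) = 0 :=
      Finset.sum_eq_zero fun j hj => by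
        rw [max_eq_right (hanti (Finset.mem_Ico.1 hj).1), div_self (hlam m).ne', log_one, mul_zero]
    rw [h3, add_zero]
    refine Finset.sum_congr rfl fun j hj => ?_
    rw [max_eq_left (hanti (Finset.mem_range.1 hj).le)]
    ring
  rw [h1, h2] at h
  have := mul_nonneg (mul_nonneg zero_le_two (hlam m).le) (sub_nonneg.2 hR)
  linarith

end QuantizationError

section HighResolution

variable {lam : ℕ → ℝ} {s b : ℝ} {φ : ℝ → ℝ}

/-- The constant of the high-resolution formula. -/
lemma waterfilling_constant (hb : 1 < b) {κ : ℝ} (hκ : 0 < κ) :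
    (2 / b * κ) ^ (1 - b) = (b / 2) ^ (b - 1) * κ ^ (1 - b) := by
  have hb0 : 0 < b := one_pos.trans hb
  rw [mul_rpow (by positivity) hκ.le, ← inv_div, inv_rpow (by positivity),
    ← rpow_neg (by positivity), neg_sub]

lemma tendsto_distortion_ratio
    (hφ_pos : ∀ x, s < x → 0 < φ x) (hφ_dec : ∀ x y, s < x → x ≤ y → φ y ≤ φ x)
    (hφ_rv : ∀ c : ℝ, 0 < c →
      Tendsto (fun x : ℝ => φ (c * x) / φ x) atTop (nhds (c ^ (-b))))
    (hasymp : Tendsto (fun j : ℕ => lam j / φ j) atTop (nhds 1))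
    (hpos : ∀ j, 0 < lam j) (hb : 1 < b)
    {m : ℕ → ℕ} {x : ℕ → ℝ} {κ : ℝ} (hκ : 0 < κ) (hx : Tendsto x atTop atTop)
    (hm : Tendsto (fun n => (m n : ℝ) / x n) atTop (nhds (2 / b * κ)))
    {T : ℕ → ℝ} {θ : ℝ}
    (hT : Tendsto (fun k => T k / (k * lam k)) atTop (nhds (b / (b - 1) * θ))) :
    Tendsto (fun n => T (m n) / ((b / 2) ^ (b - 1) * (b / (b - 1)) * (x n * φ (x n)))) atTop
      (nhds (κ ^ (1 - b) * θ)) := by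
  have hb0 : 0 < b := one_pos.trans hb
  have hb1 : 0 < b - 1 := sub_pos.2 hb
  have hc : 0 < 2 / b * κ := by positivity
  have hmt : Tendsto m atTop atTop :=
    tendsto_natCast_atTop_iff.1 (tendsto_atTop_of_ratio hc hx hm)
  have h1 := (hT.comp hmt).mul
    (hm.mul (tendsto_eigenvalue_div hφ_pos hφ_dec hφ_rv hasymp hc hx hm))
  have h2 : 2 / b * κ * (2 / b * κ) ^ (-b) = (b / 2) ^ (b - 1) * κ ^ (1 - b) := by
    rw [← waterfilling_constant hb hκ, sub_eq_add_neg, rpow_add hc, rpow_one]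
  rw [h2] at h1
  have hK : 0 < (b / 2) ^ (b - 1) := by positivity
  have h3 := h1.div_const ((b / 2) ^ (b - 1) * (b / (b - 1)))
  have h4 : b / (b - 1) * θ * ((b / 2) ^ (b - 1) * κ ^ (1 - b)) /
      ((b / 2) ^ (b - 1) * (b / (b - 1))) = κ ^ (1 - b) * θ := by
    field_simp
  rw [h4] at h3
  refine h3.congr' ?_
  filter_upwards [hx.eventually_gt_atTop 0, hx.eventually_gt_atTop s,
    hmt.eventually_gt_atTop 0] with n hn0 hns hmn
  have h5 := hφ_pos _ hns
  have h6 : (0 : ℝ) < m n := by exact_mod_cast hmn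
  have h7 := hpos (m n)
  simp only [Function.comp]
  field_simp

end HighResolution

/-- High-resolution formula for the quantization errors of a centered Gaussian random vector
with regularly varying covariance eigenvalues:
`e_n(X) ~ ((b/2)^{b-1} · b/(b-1))^{1/2} · ψ(log n)^{-1/2}` where `ψ(x) = 1/(x φ(x))`. -/
theorem quantization_high_resolution_formula
    {H : Type*} [NormedAddCommGroup H] [InnerProductSpace ℝ H] [CompleteSpace H]
    [TopologicalSpace.SeparableSpace H]
    {Ω : Type*} [MeasurableSpace Ω] (P : Measure Ω) [IsProbabilityMeasure P]
    (X : Ω → H)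
    (hXmeas : AEStronglyMeasurable X P)
    (hXint : Integrable (fun ω => ‖X ω‖ ^ 2) P)
    -- `X` is a centered Gaussian random vector: every 1-dimensional projection is
    -- a centered Gaussian on `ℝ`
    (hGauss : ∀ y : H, ∃ v : ℝ≥0,
      Measure.map (fun ω => ⟪y, X ω⟫) P = gaussianReal 0 v)
    -- `lam` enumerates (in nonincreasing order, with multiplicity) the nonzero eigenvalues
    -- of the covariance operator `C_X y = E(⟪y,X⟫ X)`, with orthonormal eigenvectors `u`;
    -- since `lam j > 0` for all `j : ℕ`, the Cameron–Martin space is infinite dimensional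
    (u : ℕ → H) (hu : Orthonormal ℝ u)
    (lam : ℕ → ℝ) (hlam_pos : ∀ j, 0 < lam j) (hlam_anti : Antitone lam)
    (heig : ∀ j, ∀ y : H, ∫ ω, ⟪u j, X ω⟫ * ⟪y, X ω⟫ ∂P = lam j * ⟪u j, y⟫)
    -- the eigenvectors `u` span the support of the law of `X`, so that `lam` lists *all*
    -- nonzero eigenvalues
    (hspan : ∀ᵐ ω ∂P, X ω ∈ closure (Submodule.span ℝ (Set.range u) : Set H))
    -- `φ : (s,∞) → (0,∞)` is decreasing and regularly varying at infinity of index `-b`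
    (s b : ℝ) (hs : 0 ≤ s) (hb : 1 < b)
    (φ : ℝ → ℝ) (hφ_pos : ∀ x, s < x → 0 < φ x)
    (hφ_dec : ∀ x y, s < x → x ≤ y → φ y ≤ φ x)
    (hφ_rv : ∀ c : ℝ, 0 < c →
      Tendsto (fun x : ℝ => φ (c * x) / φ x) atTop (nhds (c ^ (-b))))
    -- `λ_j ~ φ(j)` as `j → ∞`
    (hasymp : Tendsto (fun j : ℕ => lam j / φ j) atTop (nhds 1)) :
    Tendsto (fun n : ℕ =>
        quantErr P X n /
          ((((b / 2) ^ (b - 1) * (b / (b - 1))) ^ (1/2 : ℝ)) *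
            ((1 / (Real.log n * φ (Real.log n))) ^ (-(1/2) : ℝ))))
      atTop (nhds 1) := by
  have hb0 : 0 < b := one_pos.trans hb
  have hb1 : 0 < b - 1 := sub_pos.2 hb
  have hK : 0 < (b / 2) ^ (b - 1) * (b / (b - 1)) := by positivity
  have hrv := seqRegVar_of_asymptotics hφ_pos hφ_dec hφ_rv hasymp
  have hS := hasSum_eigenvalues hXint hGauss hu hlam_pos heig hspan
  set S := ∫ ω, ‖X ω‖ ^ 2 ∂P
  have hx : Tendsto (fun n : ℕ => log n) atTop atTop :=
    tendsto_log_atTop.comp tendsto_natCast_atTop_atTop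
  set G : ℕ → ℝ := fun n =>
    (b / 2) ^ (b - 1) * (b / (b - 1)) * (log n * φ (log n)) with hG
  have hGpos : ∀ᶠ n in atTop, 0 < G n := by
    filter_upwards [hx.eventually_gt_atTop s, hx.eventually_gt_atTop 0] with n h1 h2
    exact mul_pos hK (mul_pos h2 (hφ_pos _ h1))
  suffices hmain : Tendsto (fun n => quantErr P X n / √(G n)) atTop (nhds 1) by
    refine hmain.congr' ?_
    filter_upwards [hx.eventually_gt_atTop s, hx.eventually_gt_atTop 0] with n h1 h2
    have h3 : 0 < log n * φ (log n) := mul_pos h2 (hφ_pos _ h1)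
    rw [hG, sqrt_mul hK.le, sqrt_eq_rpow, sqrt_eq_rpow, rpow_neg (by positivity), one_div (_ * _),
      inv_rpow h3.le, inv_inv]
  have htail := tendsto_tail_ratio hlam_pos hlam_anti hrv hb hS
  have hself : Tendsto (fun m : ℕ => m * lam m / (m * lam m)) atTop (nhds 1) := by
    refine tendsto_const_nhds.congr' ?_
    filter_upwards [eventually_gt_atTop 0] with m hm
    have : (0 : ℝ) < m := by exact_mod_cast hm
    exact (div_self (mul_pos this (hlam_pos m)).ne').symm
  have hfloor : ∀ κ : ℝ, 0 < κ →
      Tendsto (fun n : ℕ => (⌊2 / b * κ * log n⌋₊ : ℝ) / log n) atTop (nhds (2 / b * κ)) :=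
    fun κ hκ => (tendsto_nat_floor_mul_div_atTop (by positivity)).comp hx
  have hmt : ∀ κ : ℝ, 0 < κ →
      Tendsto (fun n : ℕ => ⌊2 / b * κ * log n⌋₊) atTop atTop :=
    fun κ hκ => tendsto_natCast_atTop_iff.1
      (tendsto_atTop_of_ratio (by positivity) hx (hfloor κ hκ))
  have hlog : ∀ κ : ℝ, 0 < κ → Tendsto (fun n : ℕ =>
      (∑ j ∈ Finset.range ⌊2 / b * κ * log n⌋₊, log (lam j / lam ⌊2 / b * κ * log n⌋₊)) / log n)
      atTop (nhds (2 * κ)) := by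
    intro κ hκ
    have h1 := ((tendsto_mean_log_ratio hlam_pos hlam_anti hrv).comp (hmt κ hκ)).mul (hfloor κ hκ)
    rw [show b * (2 / b * κ) = 2 * κ by field_simp] at h1
    refine h1.congr' ?_
    filter_upwards [(hmt κ hκ).eventually_gt_atTop 0] with n hn
    have : (0 : ℝ) < ⌊2 / b * κ * log n⌋₊ := by exact_mod_cast hn
    exact div_mul_div_cancel₀ this.ne'
  refine tendsto_order.2 ⟨fun a ha => ?_, fun a ha => ?_⟩
  · have hcont : ContinuousAt (fun κ : ℝ => √(κ ^ (1 - b) * 1)) 1 :=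
      ((continuousAt_rpow_const 1 (1 - b) (Or.inl one_ne_zero)).mul_const 1).sqrt
    have ha' : a < √((1 : ℝ) ^ (1 - b) * 1) := by simpa using ha
    obtain ⟨κ, hκa, hκ⟩ := (((hcont.tendsto.eventually_const_lt ha').filter_mono
      nhdsWithin_le_nhds).and (self_mem_nhdsWithin (s := Set.Ioi (1 : ℝ)))).exists
    have hκ : 1 < κ := hκ
    have hκ0 : 0 < κ := one_pos.trans hκ
    have hT := hself.add htail
    rw [show 1 + 1 / (b - 1) = b / (b - 1) * 1 by field_simp; ring] at hT
    simp_rw [← add_div] at hT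
    have hlim := (tendsto_distortion_ratio hφ_pos hφ_dec hφ_rv hasymp hlam_pos hb hκ0 hx
      (hfloor κ hκ0) hT).sqrt
    filter_upwards [hlim.eventually_const_lt hκa, hGpos, eventually_gt_atTop 0,
      (hlog κ hκ0).eventually_const_lt (by linarith : 2 < 2 * κ),
      hx.eventually_gt_atTop 0] with n h1 h2 h3 h4 h5
    refine h1.trans_le ?_
    rw [sqrt_div' _ h2.le]
    gcongr
    refine sqrt_waterfilling_le_quantErr hXmeas hXint hGauss hu hlam_pos hlam_anti heig hS h3 ?_
    rw [lt_div_iff₀ h5] at h4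
    linarith
  · have hcont : ContinuousAt
        (fun κ : ℝ => √(κ ^ (1 - b) * (1 + (1 - κ) / 8 * ((b - 1) / b)))) 1 :=
      ((continuousAt_rpow_const 1 (1 - b) (Or.inl one_ne_zero)).mul (by fun_prop)).sqrt
    have ha' : √((1 : ℝ) ^ (1 - b) * (1 + (1 - 1) / 8 * ((b - 1) / b))) < a := by simpa using ha
    obtain ⟨κ, ⟨hκa, hκ0⟩, hκ⟩ := ((((hcont.tendsto.eventually_lt_const ha').and
      (lt_mem_nhds one_pos)).filter_mono nhdsWithin_le_nhds).and
      (self_mem_nhdsWithin (s := Set.Iio (1 : ℝ)))).exists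
    have hκ : κ < 1 := hκ
    set ε := (1 - κ) / 8 with hε
    have hε0 : 0 < ε := by rw [hε]; linarith
    have hε1 : ε < 1 := by rw [hε]; linarith
    obtain ⟨σ, K, hσ0, hσ1, hK0, hcode⟩ := exists_codebook_integral_le hXmeas hXint hGauss hu
      hlam_pos hlam_anti heig hε0 hε1
    have hT := (htail.add (hself.mul_const (1 + ε))).add
      (tendsto_geometric_div hlam_pos hlam_anti hrv hσ0 hσ1 hK0)
    rw [show 1 / (b - 1) + 1 * (1 + ε) + 0 = b / (b - 1) * (1 + ε * ((b - 1) / b)) by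
      field_simp; ring] at hT
    simp_rw [div_mul_eq_mul_div _ _ (1 + ε), ← add_div] at hT
    have hlim := (tendsto_distortion_ratio hφ_pos hφ_dec hφ_rv hasymp hlam_pos hb hκ0 hx
      (hfloor κ hκ0) hT).sqrt
    have hrate := ((hlog κ hκ0).div_const 2).add ((hfloor κ hκ0).const_mul (2 * ε))
    have hrate_lt : 2 * κ / 2 + 2 * ε * (2 / b * κ) < 1 := by
      have h1 : 2 / b < 2 := by rw [div_lt_iff₀ hb0]; linarith
      have h2 : 2 * ε * (2 / b * κ) ≤ 2 * ε * (2 * κ) := by gcongr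
      rw [hε] at h2 ⊢
      nlinarith
    obtain ⟨r, hr1, hr2⟩ := exists_between hrate_lt
    filter_upwards [hlim.eventually_lt_const hκa, hGpos, eventually_ge_atTop 2,
      hrate.eventually_lt_const hr1, hx.eventually_gt_atTop 0,
      hx.eventually_ge_atTop (log 2 / (1 - r))] with n h1 h2 h3 h4 h5 h6
    refine lt_of_le_of_lt ?_ h1
    rw [sqrt_div' _ h2.le]
    gcongr
    set m := ⌊2 / b * κ * log n⌋₊
    have hn2 : (2 : ℝ) ≤ n := by exact_mod_cast h3
    have hexp : exp (∑ j : Fin m, 1 / 2 * log (lam j / lam m) + 2 * ε * m) ≤ (n - 1 : ℕ) := by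
      rw [Fin.sum_univ_eq_sum_range (fun j => 1 / 2 * log (lam j / lam m)) m, ← Finset.mul_sum]
      have h7 : 1 / 2 * ∑ j ∈ Finset.range m, log (lam j / lam m) + 2 * ε * m ≤ log (n / 2) := by
        rw [div_le_iff₀ (by linarith)] at h6
        rw [log_div (by linarith) (by norm_num)]
        have h8 := mul_lt_mul_of_pos_right h4 h5
        have h9 : ((∑ j ∈ Finset.range m, log (lam j / lam m)) / log n / 2 +
            2 * ε * (m / log n)) * log n =
            1 / 2 * ∑ j ∈ Finset.range m, log (lam j / lam m) + 2 * ε * m := by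
          field_simp
        linarith
      refine (exp_le_exp.2 h7).trans ?_
      rw [exp_log (by linarith), Nat.cast_sub (by lia)]
      push_cast
      linarith
    obtain ⟨α, hα, hαn, hle⟩ := hcode m (n - 1) hexp
    rw [Fin.sum_univ_eq_sum_range lam m] at hle
    exact quantErr_le_sqrt hα (by lia) hle
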